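/- Fix ρ ∈ (0,1), ι ∈ (0,1/2), and M, Δ > 0. Let Γ be a Borel probability measure on ℝ^d that is sub-exponential (∫ exp(λ‖X‖) dΓ(X) < ∞ for some λ > 0) and such that Γ_ρ := ρ·((1−ρ)·Γ) + (1−ρ)·((−ρ)·Γ) is spread out. Then there exist λ₁ > 0, β ∈ (0,1), b > 0 and L > 1 such that for every measurable allocation function g: ℝ^d × ℝ^d → [ι, 1−ι] satisfying the (M,Δ)-negative feedback condition, with V(Λ) := exp(λ₁‖Λ‖): (i) the kernel P_g admits a unique invariant probability measure π_g; (ii) ∫ V dπ_g ≤ b/(1−β); and (iii) for every n ≥ 0, every Λ ∈ ℝ^d and every measurable f: ℝ^d → ℝ with |f(x)| ≤ V(x) for all x, one has |(P_g^n f)(Λ) − ∫ f dπ_g| ≤ L·(1 − L^{−1})^n · V(Λ). -/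

import Mathlib

open MeasureTheory ProbabilityTheory Filter Set
open scoped ENNReal RealInnerProductSpace

noncomputable section

/-- `ℝ^d` with the Euclidean norm. -/
abbrev Ed (d : ℕ) : Type := EuclideanSpace ℝ (Fin d)

/-- Action of the CAR transition kernel `P_g` on a function `h`:
`(P_g h)(Λ) = ∫ [ g(Λ,X)·h(Λ + (1−ρ)X) + (1−g(Λ,X))·h(Λ − ρX) ] dΓ(X)`. -/
def kernelOp (d : ℕ) (ρ : ℝ) (Γ : Measure (Ed d)) (g : Ed d → Ed d → ℝ)
    (h : Ed d → ℝ) (Λ : Ed d) : ℝ :=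
  ∫ X, g Λ X * h (Λ + (1 - ρ) • X) + (1 - g Λ X) * h (Λ - ρ • X) ∂Γ

/-- `W_Γ`: the linear span of the topological support of `Γ` (the set of points all of
whose open neighbourhoods have positive measure). -/
def suppSpan (d : ℕ) (Γ : Measure (Ed d)) : Submodule ℝ (Ed d) :=
  Submodule.span ℝ {x : Ed d | ∀ U : Set (Ed d), IsOpen U → x ∈ U → 0 < Γ U}

/-- The `(M,Δ)`-negative feedback condition for an allocation function `g`. -/
def NegFeedback (d : ℕ) (ρ M Δ : ℝ) (Γ : Measure (Ed d)) (g : Ed d → Ed d → ℝ) : Prop :=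
  ∀ Λ : Ed d, Λ ∈ suppSpan d Γ → M ≤ ‖Λ‖ →
    (∫ X, (g Λ X - ρ) * (⟪X, Λ⟫ / ‖Λ‖) ∂Γ) ≤ -Δ

/-- `Γ` is sub-exponential: `∫ exp(λ‖X‖) dΓ(X) < ∞` for some `λ > 0`. -/
def SubExp (d : ℕ) (Γ : Measure (Ed d)) : Prop :=
  ∃ l : ℝ, 0 < l ∧ Integrable (fun x => Real.exp (l * ‖x‖)) Γ

/-- `k`-fold convolution power of a measure (`convPow μ 0` is the Dirac mass at `0`). -/
def convPow (d : ℕ) (μ : Measure (Ed d)) : ℕ → Measure (Ed d)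
  | 0 => Measure.dirac 0
  | n + 1 => ((convPow d μ n).prod μ).map (fun p => p.1 + p.2)

/-- A measure is spread out if some convolution power dominates `f·Leb` for a nonnegative
measurable `f` with `∫ f dLeb > 0`. -/
def SpreadOut (d : ℕ) (μ : Measure (Ed d)) : Prop :=
  ∃ k : ℕ, 0 < k ∧ ∃ f : Ed d → ℝ, Measurable f ∧ (∀ x, 0 ≤ f x) ∧
    (0 < ∫ x, f x) ∧
    ∀ A : Set (Ed d), MeasurableSet A →
      ENNReal.ofReal (∫ x in A, f x) ≤ convPow d μ k A

/-- `Γ_ρ`: the mixture `ρ·((1−ρ)·Γ) + (1−ρ)·((−ρ)·Γ)` of the pushforwards of `Γ` under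
scalar multiplication by `1−ρ` and by `−ρ`. -/
def mixMeasure (d : ℕ) (ρ : ℝ) (Γ : Measure (Ed d)) : Measure (Ed d) :=
  ENNReal.ofReal ρ • Γ.map (fun x => (1 - ρ) • x) +
    ENNReal.ofReal (1 - ρ) • Γ.map (fun x => (-ρ) • x)

/-- `π` is an invariant probability measure for the kernel `P_g`:
`π(A) = ∫ P_g(Λ, A) dπ(Λ)` for every Borel set `A`. -/
def IsInvariantMeasure (d : ℕ) (ρ : ℝ) (Γ : Measure (Ed d)) (g : Ed d → Ed d → ℝ)
    (π : Measure (Ed d)) : Prop :=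
  ∀ A : Set (Ed d), MeasurableSet A →
    (π A).toReal = ∫ Λ, kernelOp d ρ Γ g (A.indicator fun _ => (1 : ℝ)) Λ ∂π

section Harris

variable {E : Type*} [MeasurableSpace E]

lemma isMarkovKernel_pow (κ : Kernel E E) [IsMarkovKernel κ] (n : ℕ) :
    IsMarkovKernel (κ ^ n) := by
  induction n with
  | zero => exact inferInstanceAs (IsMarkovKernel (Kernel.id : Kernel E E))
  | succ n ih => exact inferInstanceAs (IsMarkovKernel ((κ ^ n) ∘ₖ κ))

/-- The one-step Harris contraction (Hairer–Mattingly): a drift condition together with a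
minorization on a sublevel set contracts weighted oscillations. -/
lemma harris_contraction {Q : Kernel E E} [IsMarkovKernel Q] {V : E → ℝ}
    (hV0 : ∀ x, 0 ≤ V x) {γ K R δ c α : ℝ}
    (hint : ∀ x, Integrable V (Q x)) (hdrift : ∀ x, ∫ z, V z ∂Q x ≤ γ * V x + K)
    (hδ : 0 < δ) (hδK : 2 * δ * K ≤ c)
    {ν : Measure E} [IsFiniteMeasure ν] (hν : ν.real univ = c)
    (hmin : ∀ x, V x ≤ R → ν ≤ Q x)
    (hα₁ : 1 - c / 2 ≤ α) (hα₂ : γ ≤ α) (hα₃ : 2 + δ * (γ * R + 2 * K) ≤ α * (2 + δ * R))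
    {φ : E → ℝ} (hφ : Measurable φ) {D : ℝ} (hD : 0 ≤ D)
    (h : ∀ x y, φ x - φ y ≤ D * (2 + δ * V x + δ * V y)) (x y : E) :
    ∫ z, φ z ∂Q x - ∫ z, φ z ∂Q y ≤ α * (D * (2 + δ * V x + δ * V y)) := by
  have : Nonempty E := ⟨x⟩
  obtain ⟨t, ht⟩ : ∃ t : ℝ, ∀ z, |φ z - t| ≤ D * (1 + δ * V z) := by
    have hb : ∀ z w, φ z - D * (1 + δ * V z) ≤ φ w + D * (1 + δ * V w) := fun z w => by
      have := h z w
      nlinarith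
    refine ⟨⨆ z, (φ z - D * (1 + δ * V z)), fun z => abs_le.2 ⟨?_, ?_⟩⟩
    · have := ciSup_le fun w => hb w z
      linarith
    · have := le_ciSup (f := fun z => φ z - D * (1 + δ * V z))
        ⟨φ z + D * (1 + δ * V z), by rintro _ ⟨w, rfl⟩; exact hb w z⟩ z
      linarith
  set ψ : E → ℝ := fun z => D * (1 + δ * V z) with hψ
  have iψ : ∀ x, Integrable ψ (Q x) := fun x =>
    ((integrable_const 1).add ((hint x).const_mul δ)).const_mul D
  have iφt : ∀ x, Integrable (fun z => φ z - t) (Q x) := fun x =>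
    (iψ x).mono' (by fun_prop) (ae_of_all _ fun z => ht z)
  have iφ : ∀ x, Integrable φ (Q x) := fun x =>
    ((iφt x).add (integrable_const t)).congr (ae_of_all _ fun z => by simp)
  have eψ : ∀ x, ∫ z, ψ z ∂Q x ≤ D * (1 + δ * (γ * V x + K)) := fun x => by
    have : ∫ z, ψ z ∂Q x = D * (1 + δ * ∫ z, V z ∂Q x) := by
      simp only [hψ]
      rw [integral_const_mul, integral_add (integrable_const _) ((hint x).const_mul δ),
        integral_const_mul]
      simp
    rw [this]
    gcongr
    exact hdrift x
  have et : ∀ x, ∫ z, (φ z - t) ∂Q x = ∫ z, φ z ∂Q x - t := fun x => by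
    rw [integral_sub (iφ x) (integrable_const _)]
    simp
  have up : ∀ x, ∫ z, (φ z - t) ∂Q x ≤ ∫ z, ψ z ∂Q x := fun x =>
    integral_mono (iφt x) (iψ x) fun z => (abs_le.1 (ht z)).2
  have lo : ∀ x, -∫ z, ψ z ∂Q x ≤ ∫ z, (φ z - t) ∂Q x := fun x => by
    rw [← integral_neg]
    exact integral_mono (iψ x).neg (iφt x) fun z => (abs_le.1 (ht z)).1
  have hx := eψ x
  have hy := eψ y
  have hVx := hV0 x
  have hVy := hV0 y
  by_cases hs : R ≤ V x + V y
  · have h1 := up x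
    have h2 := lo y
    rw [et] at h1 h2
    have h3 : 2 + δ * (γ * (V x + V y) + 2 * K) ≤ α * (2 + δ * (V x + V y)) := by
      nlinarith [mul_nonneg (mul_nonneg (sub_nonneg.2 hα₂) hδ.le) (sub_nonneg.2 hs)]
    nlinarith [mul_le_mul_of_nonneg_left h3 hD]
  · have nx := hmin x (by linarith)
    have ny := hmin y (by linarith)
    have iψν : Integrable ψ ν := (iψ x).mono_measure nx
    have iφν : Integrable (fun z => φ z - t) ν := (iφt x).mono_measure nx
    have h1 : ∫ z, (ψ z - (φ z - t)) ∂ν ≤ ∫ z, (ψ z - (φ z - t)) ∂Q x :=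
      integral_mono_measure nx (ae_of_all _ fun z => sub_nonneg.2 (abs_le.1 (ht z)).2)
        ((iψ x).sub (iφt x))
    have h2 : ∫ z, (ψ z + (φ z - t)) ∂ν ≤ ∫ z, (ψ z + (φ z - t)) ∂Q y :=
      integral_mono_measure ny
        (ae_of_all _ fun z => by
          have := (abs_le.1 (ht z)).1
          simp only [Pi.zero_apply]
          linarith)
        ((iψ y).add (iφt y))
    rw [integral_sub iψν iφν, integral_sub (iψ x) (iφt x), et] at h1
    rw [integral_add iψν iφν, integral_add (iψ y) (iφt y), et] at h2
    have h3 : D * c ≤ ∫ z, ψ z ∂ν := by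
      have : ∫ z, D ∂ν ≤ ∫ z, ψ z ∂ν := integral_mono (integrable_const _) iψν fun z => by
        have := hV0 z
        simp only [hψ]
        nlinarith [mul_nonneg hD (mul_nonneg hδ.le this)]
      rw [integral_const, hν, smul_eq_mul] at this
      linarith
    have h4 : 2 + δ * (γ * (V x + V y) + 2 * K) - 2 * c ≤ α * (2 + δ * (V x + V y)) := by
      nlinarith [mul_nonneg (sub_nonneg.2 hα₂) (mul_nonneg hδ.le (add_nonneg hVx hVy))]
    nlinarith [mul_le_mul_of_nonneg_left h4 hD]

lemma drift_pow {κ : Kernel E E} [IsMarkovKernel κ] {V : E → ℝ} (hVm : Measurable V)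
    (hV0 : ∀ x, 0 ≤ V x) {β b : ℝ} (hβ : β ∈ Ioo (0 : ℝ) 1)
    (hint : ∀ x, Integrable V (κ x)) (hdrift : ∀ x, ∫ z, V z ∂κ x ≤ β * V x + b)
    (n : ℕ) (x : E) :
    Integrable V ((κ ^ n) x) ∧
      ∫ z, V z ∂(κ ^ n) x ≤ β ^ n * V x + (1 - β ^ n) * (b / (1 - β)) := by
  have hm := isMarkovKernel_pow κ
  induction n with
  | zero =>
    have h : (κ ^ 0) x = Measure.dirac x := by rw [pow_zero]; exact Kernel.id_apply x
    rw [h, integral_dirac' _ _ hVm.stronglyMeasurable]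
    exact ⟨(integrable_dirac' hVm.stronglyMeasurable (by simp [enorm])), by simp⟩
  | succ n ih =>
    obtain ⟨ih1, ih2⟩ := ih
    have e : κ ^ (n + 1) = κ ∘ₖ (κ ^ n) := pow_succ' κ n
    have i1 : Integrable (fun z => β * V z + b) ((κ ^ n) x) :=
      (ih1.const_mul β).add (integrable_const b)
    have i2 : Integrable V ((κ ^ (n + 1)) x) := by
      rw [e, integrable_comp_iff hVm.aestronglyMeasurable]
      refine ⟨ae_of_all _ hint, i1.mono' ?_ (ae_of_all _ fun z => ?_)⟩
      · exact (hVm.norm.stronglyMeasurable.integral_kernel).aestronglyMeasurable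
      · rw [Real.norm_of_nonneg (integral_nonneg fun _ => norm_nonneg _)]
        simpa only [Real.norm_of_nonneg (hV0 _)] using hdrift z
    refine ⟨i2, ?_⟩
    rw [e] at i2 ⊢
    rw [Kernel.integral_comp i2]
    calc ∫ z, ∫ w, V w ∂κ z ∂(κ ^ n) x ≤ ∫ z, (β * V z + b) ∂(κ ^ n) x :=
          integral_mono i2.integral_comp i1 hdrift
      _ = β * ∫ z, V z ∂(κ ^ n) x + b := by
          rw [integral_add (ih1.const_mul β) (integrable_const b), integral_const_mul]; simp
      _ ≤ β * (β ^ n * V x + (1 - β ^ n) * (b / (1 - β))) + b := by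
          have := hβ.1
          gcongr
      _ = β ^ (n + 1) * V x + (1 - β ^ (n + 1)) * (b / (1 - β)) := by
          have : 1 - β ≠ 0 := by linarith [hβ.2]
          field_simp
          ring

/-- Iterating an oscillation contraction of a kernel. -/
lemma oscillation_pow_le {Q : Kernel E E} [IsMarkovKernel Q] {W : E → E → ℝ} {α : ℝ}
    (hα : 0 ≤ α)
    (hint : ∀ φ : E → ℝ, Measurable φ → ∀ D, 0 ≤ D → (∀ x y, φ x - φ y ≤ D * W x y) →
      ∀ n x, Integrable φ ((Q ^ n) x))
    (hcon : ∀ φ : E → ℝ, Measurable φ → ∀ D, 0 ≤ D → (∀ x y, φ x - φ y ≤ D * W x y) →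
      ∀ x y, ∫ z, φ z ∂Q x - ∫ z, φ z ∂Q y ≤ α * (D * W x y))
    {φ : E → ℝ} (hφ : Measurable φ) {D : ℝ} (hD : 0 ≤ D)
    (h : ∀ x y, φ x - φ y ≤ D * W x y) (n : ℕ) (x y : E) :
    ∫ z, φ z ∂(Q ^ n) x - ∫ z, φ z ∂(Q ^ n) y ≤ α ^ n * D * W x y := by
  have hm := isMarkovKernel_pow Q
  induction n generalizing x y with
  | zero =>
    have e : ∀ x, (Q ^ 0) x = Measure.dirac x := fun x => by
      rw [pow_zero]; exact Kernel.id_apply x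
    rw [e, e, integral_dirac' _ _ hφ.stronglyMeasurable, integral_dirac' _ _ hφ.stronglyMeasurable]
    simpa using h x y
  | succ n ih =>
    have e : Q ^ (n + 1) = (Q ^ n) ∘ₖ Q := pow_succ Q n
    have hi := hint φ hφ D hD h (n + 1)
    rw [e] at hi ⊢
    rw [Kernel.integral_comp (hi x), Kernel.integral_comp (hi y)]
    have := hcon (fun z => ∫ w, φ w ∂(Q ^ n) z)
      (hφ.stronglyMeasurable.integral_kernel).measurable (α ^ n * D) (by positivity) ih x y
    rw [pow_succ']
    linarith

end Harris

section SetwiseLimit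

open scoped Topology

variable {E : Type*} [MeasurableSpace E]

/-- A sequence of probability measures which is Cauchy in total variation converges setwise to a
probability measure. -/
lemma exists_setwise_limit {μ : ℕ → Measure E} [∀ n, IsProbabilityMeasure (μ n)] {ε : ℕ → ℝ}
    (hε : Tendsto ε atTop (𝓝 0))
    (h : ∀ n k A, MeasurableSet A → |(μ (n + k)).real A - (μ n).real A| ≤ ε n) :
    ∃ π : Measure E, IsProbabilityMeasure π ∧
      ∀ A, MeasurableSet A → Tendsto (fun n => (μ n).real A) atTop (𝓝 (π.real A)) := by
  have hex : ∀ A, MeasurableSet A → ∃ l : ℝ, Tendsto (fun n => (μ n).real A) atTop (𝓝 l) := by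
    intro A hA
    refine cauchySeq_tendsto_of_complete (cauchySeq_of_le_tendsto_0' ε (fun n m hnm => ?_) hε)
    obtain ⟨k, rfl⟩ := Nat.exists_eq_add_of_le hnm
    rw [dist_comm, Real.dist_eq]
    exact h n k A hA
  choose m hm using hex
  have hm_nonneg : ∀ A hA, 0 ≤ m A hA := fun A hA =>
    ge_of_tendsto' (hm A hA) fun _ => measureReal_nonneg
  have hmε : ∀ n A hA, |m A hA - (μ n).real A| ≤ ε n := fun n A hA => by
    have h1 : Tendsto (fun k => (μ (n + k)).real A) atTop (𝓝 (m A hA)) :=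
      ((tendsto_add_atTop_iff_nat n).2 (hm A hA)).congr fun k => by rw [add_comm]
    exact le_of_tendsto' (h1.sub_const _).abs fun k => h n k A hA
  have hsum : ∀ ⦃f : ℕ → Set E⦄ (hf : ∀ i, MeasurableSet (f i)), Pairwise (Function.onFun Disjoint f) →
      HasSum (fun i => m (f i) (hf i)) (m (⋃ i, f i) (MeasurableSet.iUnion hf)) := by
    intro f hf hd
    have hU : ∀ s : Finset ℕ, MeasurableSet (⋃ i ∈ s, f i) := fun s =>
      s.measurableSet_biUnion fun i _ => hf i
    have e1 : ∀ s : Finset ℕ, ∑ i ∈ s, m (f i) (hf i) = m (⋃ i ∈ s, f i) (hU s) := fun s => by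
      refine tendsto_nhds_unique (tendsto_finsetSum s fun i _ => hm (f i) (hf i)) ?_
      refine (hm _ (hU s)).congr fun n => ?_
      exact measureReal_biUnion_finset (fun i _ j _ hij => hd hij) fun i _ => hf i
    have hunif : TendstoUniformlyOnFilter (fun n (s : Finset ℕ) => ∑ i ∈ s, (μ n).real (f i))
        (fun s => ∑ i ∈ s, m (f i) (hf i)) atTop atTop := by
      rw [Metric.tendstoUniformlyOnFilter_iff]
      intro e he
      have h1 : ∀ᶠ n in atTop, ε n < e := hε.eventually_lt_const he
      filter_upwards [h1.prod_inl (atTop : Filter (Finset ℕ))] with p hp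
      rw [e1, Real.dist_eq, ← measureReal_biUnion_finset (fun i _ j _ hij => hd hij)
        fun i _ => hf i]
      exact (hmε _ _ _).trans_lt hp
    refine hunif.tendsto_of_eventually_tendsto
      (Eventually.of_forall fun n => ?_) (hm _ (MeasurableSet.iUnion hf))
    have := hasSum_integral_iUnion (μ := μ n) (f := fun _ => (1 : ℝ)) hf hd
      (integrable_const _).integrableOn
    simpa [HasSum] using this
  have hm0 : m ∅ MeasurableSet.empty = 0 :=
    tendsto_nhds_unique (hm _ _) (by simp)
  let π : Measure E := Measure.ofMeasurable (fun A hA => ENNReal.ofReal (m A hA))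
    (by simp [hm0]) (fun f hf hd => by
      rw [← (hsum hf hd).tsum_eq, ENNReal.ofReal_tsum_of_nonneg (fun i => hm_nonneg _ _)
        (hsum hf hd).summable])
  have hπ : ∀ A (hA : MeasurableSet A), π A = ENNReal.ofReal (m A hA) := fun A hA =>
    Measure.ofMeasurable_apply A hA
  refine ⟨π, ⟨?_⟩, fun A hA => ?_⟩
  · rw [hπ _ MeasurableSet.univ,
      tendsto_nhds_unique (hm univ MeasurableSet.univ) (by simp : Tendsto _ _ (𝓝 (1 : ℝ)))]
    simp
  · rw [measureReal_def, hπ A hA, ENNReal.toReal_ofReal (hm_nonneg A hA)]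
    exact hm A hA

lemma tendsto_integral_of_setwise {μ : ℕ → Measure E} [∀ n, IsProbabilityMeasure (μ n)]
    {π : Measure E} [IsProbabilityMeasure π]
    (h : ∀ A, MeasurableSet A → Tendsto (fun n => (μ n).real A) atTop (𝓝 (π.real A)))
    {f : E → ℝ} (hf : Measurable f) (hf0 : ∀ x, 0 ≤ f x) (hf1 : ∀ x, f x ≤ 1) :
    Tendsto (fun n => ∫ x, f x ∂μ n) atTop (𝓝 (∫ x, f x ∂π)) := by
  have hi : ∀ ν : Measure E, IsProbabilityMeasure ν → Integrable f ν := fun ν _ =>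
    Integrable.of_bound hf.aestronglyMeasurable 1 (ae_of_all _ fun x => by
      rw [Real.norm_of_nonneg (hf0 x)]; exact hf1 x)
  have e : ∀ ν : Measure E, IsProbabilityMeasure ν →
      ∫ x, f x ∂ν = ∫ t in Ioi 0, ν.real {a | t < f a} := fun ν hν =>
    (hi ν hν).integral_eq_integral_meas_lt (ae_of_all _ hf0)
  simp_rw [e _ inferInstance]
  refine tendsto_integral_of_dominated_convergence ((Iic (1 : ℝ)).indicator fun _ => 1)
    (fun n => ?_) ?_ (fun n => ae_of_all _ fun t => ?_) (ae_of_all _ fun t => ?_)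
  · refine (Antitone.measurable fun s t hst => ?_).aestronglyMeasurable
    exact measureReal_mono fun x hx => lt_of_le_of_lt hst hx
  · rw [integrable_indicator_iff measurableSet_Iic]
    refine integrableOn_const ?_
    rw [Measure.restrict_apply measurableSet_Iic]
    simp [Iic_inter_Ioi]
  · rw [Real.norm_of_nonneg measureReal_nonneg]
    by_cases ht : t ≤ 1
    · rw [indicator_of_mem (mem_Iic.2 ht)]
      exact measureReal_le_one
    · have : {a | t < f a} = ∅ := by
        ext a
        simpa using (hf1 a).trans (not_le.1 ht).le
      simp [this, indicator_of_notMem (show t ∉ Iic (1 : ℝ) from ht)]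
  · exact h _ (measurableSet_lt measurable_const hf)

lemma measureReal_bind {μ : Measure E} (κ : Kernel E E) [IsMarkovKernel κ]
    {A : Set E} (hA : MeasurableSet A) :
    (μ.bind κ).real A = ∫ x, (κ x).real A ∂μ := by
  rw [measureReal_def, Measure.bind_apply hA κ.aemeasurable]
  simp_rw [measureReal_def]
  rw [integral_toReal (κ.measurable_coe hA).aemeasurable (ae_of_all _ fun x => measure_lt_top _ _)]

end SetwiseLimit

section HarrisTheorem

open scoped Topology

variable {E : Type*} [MeasurableSpace E]

lemma invariant_pow {κ : Kernel E E} {π : Measure E} (h : κ.Invariant π) (n : ℕ) :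
    (κ ^ n).Invariant π := by
  induction n with
  | zero => rw [pow_zero]; exact Measure.id_comp
  | succ n ih => exact ih.comp h

lemma integral_of_invariant {κ : Kernel E E} {π : Measure E} (h : κ.Invariant π)
    {f : E → ℝ} (hf : Integrable f π) : ∫ x, f x ∂π = ∫ x, ∫ y, f y ∂κ x ∂π := by
  have e : π = (κ ∘ₖ (Kernel.const Unit π)) () := by
    rw [← Measure.comp_eq_comp_const_apply]; exact h.def.symm
  conv_lhs => rw [e]
  rw [Kernel.integral_comp (by rwa [← e])]
  simp

/-- Under a drift condition every invariant probability measure integrates the drift function. -/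
lemma integrable_of_invariant_of_drift {κ : Kernel E E} [IsMarkovKernel κ] {V : E → ℝ}
    (hVm : Measurable V) (hV0 : ∀ x, 0 ≤ V x) {β b : ℝ} (hβ : β ∈ Ioo (0 : ℝ) 1) (hb : 0 < b)
    (hint : ∀ x, Integrable V (κ x)) (hdrift : ∀ x, ∫ z, V z ∂κ x ≤ β * V x + b)
    {π : Measure E} [IsProbabilityMeasure π] (hπ : κ.Invariant π) :
    Integrable V π ∧ ∫ x, V x ∂π ≤ b / (1 - β) := by
  have hm := isMarkovKernel_pow κ
  set K := b / (1 - β) with hK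
  have hK0 : 0 < K := div_pos hb (by linarith [hβ.2])
  have imin : ∀ (ν : Measure E) [IsProbabilityMeasure ν] (f : E → ℝ), Measurable f →
      (∀ x, 0 ≤ f x) → ∀ k : ℕ, Integrable (fun x => min (f x) k) ν := fun ν _ f hf hf0 k =>
    Integrable.of_bound (by fun_prop) (k : ℝ) (ae_of_all _ fun x => by
      rw [Real.norm_of_nonneg (le_min (hf0 x) (Nat.cast_nonneg k))]
      exact min_le_right _ _)
  have key : ∀ k : ℕ, ∫ x, min (V x) k ∂π ≤ K := by
    intro k
    have step : ∀ n : ℕ, ∫ x, min (V x) k ∂π ≤ ∫ x, min (β ^ n * V x + K) k ∂π := fun n => by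
      have hβn : 0 ≤ β ^ n := pow_nonneg hβ.1.le n
      have hβn1 : β ^ n ≤ 1 := pow_le_one₀ hβ.1.le hβ.2.le
      rw [integral_of_invariant (invariant_pow hπ n) (imin π V hVm hV0 k)]
      have hle : ∀ x, ∫ y, min (V y) k ∂(κ ^ n) x ≤ min (β ^ n * V x + K) k := fun x => by
        obtain ⟨i1, i2⟩ := drift_pow hVm hV0 hβ hint hdrift n x
        refine le_min ?_ ?_
        · calc ∫ y, min (V y) k ∂(κ ^ n) x ≤ ∫ y, V y ∂(κ ^ n) x :=
                integral_mono (imin _ V hVm hV0 k) i1 fun y => min_le_left _ _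
            _ ≤ _ := by nlinarith
        · calc ∫ y, min (V y) k ∂(κ ^ n) x ≤ ∫ y, (k : ℝ) ∂(κ ^ n) x :=
                integral_mono (imin _ V hVm hV0 k) (integrable_const _) fun y => min_le_right _ _
            _ = k := by simp
      have i3 : Integrable (fun x => min (β ^ n * V x + K) k) π :=
        imin π _ (by fun_prop) (fun x => by have := hV0 x; positivity) k
      refine integral_mono (i3.mono' ?_ (ae_of_all _ fun x => ?_)) i3 hle
      · exact ((hVm.min measurable_const).stronglyMeasurable.integral_kernel).aestronglyMeasurable
      · rw [Real.norm_of_nonneg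
          (integral_nonneg fun y => le_min (hV0 y) (Nat.cast_nonneg k))]
        exact hle x
    have lim : Tendsto (fun n : ℕ => ∫ x, min (β ^ n * V x + K) k ∂π) atTop
        (𝓝 (∫ x, min K k ∂π)) := by
      refine tendsto_integral_of_dominated_convergence (fun _ => (k : ℝ))
        (fun n => by fun_prop) (integrable_const _)
        (fun n => ae_of_all _ fun x => ?_) (ae_of_all _ fun x => ?_)
      · have := hV0 x
        have := pow_nonneg hβ.1.le n
        rw [Real.norm_of_nonneg (le_min (by positivity) (Nat.cast_nonneg k))]
        exact min_le_right _ _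
      · have h0 : Tendsto (fun n : ℕ => β ^ n * V x + K) atTop (𝓝 (0 * V x + K)) :=
          ((tendsto_pow_atTop_nhds_zero_of_lt_one hβ.1.le hβ.2).mul_const _).add_const _
        rw [zero_mul, zero_add] at h0
        exact h0.min tendsto_const_nhds
    refine (ge_of_tendsto' lim step).trans ?_
    simp
  have hl : ∫⁻ x, ENNReal.ofReal (V x) ∂π ≤ ENNReal.ofReal K := by
    have lim : Tendsto (fun k : ℕ => ∫⁻ x, ENNReal.ofReal (min (V x) k) ∂π) atTop
        (𝓝 (∫⁻ x, ENNReal.ofReal (V x) ∂π)) := by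
      refine lintegral_tendsto_of_tendsto_of_monotone (fun k => by fun_prop)
        (ae_of_all _ fun x k l hkl => ?_) (ae_of_all _ fun x => ?_)
      · exact ENNReal.ofReal_le_ofReal (min_le_min_left _ (by exact_mod_cast hkl))
      · refine tendsto_const_nhds.congr' ?_
        filter_upwards [eventually_ge_atTop ⌈V x⌉₊] with k hk
        rw [min_eq_left ((Nat.le_ceil _).trans (by exact_mod_cast hk))]
    refine le_of_tendsto' lim fun k => ?_
    rw [← ofReal_integral_eq_lintegral_ofReal (imin π V hVm hV0 k)
      (ae_of_all _ fun x => le_min (hV0 x) (Nat.cast_nonneg k))]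
    exact ENNReal.ofReal_le_ofReal (key k)
  have hi : Integrable V π := by
    refine ⟨hVm.aestronglyMeasurable, ?_⟩
    rw [hasFiniteIntegral_iff_ofReal (ae_of_all _ hV0)]
    exact hl.trans_lt ENNReal.ofReal_lt_top
  refine ⟨hi, ?_⟩
  rw [← ofReal_integral_eq_lintegral_ofReal hi (ae_of_all _ hV0)] at hl
  exact (ENNReal.ofReal_le_ofReal_iff hK0.le).1 hl

set_option maxHeartbeats 1000000 in
/-- Geometric decay of the oscillation of `κ ^ n f`, with constants depending only on the drift
and minorization parameters. -/
lemma exists_oscillation_decay {β b R c : ℝ} (hβ : β ∈ Ioo (0 : ℝ) 1)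
    (hb : 0 < b) (hR : 2 * (b / (1 - β)) < (1 - β) * R) (hc : 0 < c) {N : ℕ} (hN : 0 < N) :
    ∃ L > (1 : ℝ), ∀ V : E → ℝ, Measurable V → (∀ x, 1 ≤ V x) →
      ∀ κ : Kernel E E, IsMarkovKernel κ →
      (∀ x, Integrable V (κ x)) → (∀ x, ∫ z, V z ∂κ x ≤ β * V x + b) →
      (∃ ν : Measure E, IsFiniteMeasure ν ∧ ν.real univ = c ∧ ∀ x, V x ≤ R → ν ≤ (κ ^ N) x) →
      ∀ f : E → ℝ, Measurable f → (∀ x, |f x| ≤ V x) → ∀ n x y,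
        (1 + b / (1 - β)) * |∫ z, f z ∂(κ ^ n) x - ∫ z, f z ∂(κ ^ n) y|
          ≤ L * (1 - L⁻¹) ^ n * (V x + V y) := by
  have hβ1 : 0 < 1 - β := by linarith [hβ.2]
  have hβ0 := hβ.1
  set K := b / (1 - β) with hK
  have hK0 : 0 < K := div_pos hb hβ1
  have hR0 : 0 < R := by
    by_contra h
    nlinarith
  set δ := c / (2 * K) with hδ
  have hδ0 : 0 < δ := by positivity
  set D := K + δ⁻¹ with hD
  have hD0 : 0 < D := by positivity
  set α := max (max β (1 - c / 2)) ((2 + δ * (β * R + 2 * K)) / (2 + δ * R)) with hα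
  have hαβ : β ≤ α := (le_max_left _ _).trans (le_max_left _ _)
  have hα0 : 0 < α := hβ0.trans_le hαβ
  have hα1 : α < 1 := by
    refine max_lt (max_lt hβ.2 (by linarith)) ?_
    rw [div_lt_one (by positivity)]
    nlinarith
  have hα1' : 0 < 1 - α := by linarith
  have hα3 : 2 + δ * (β * R + 2 * K) ≤ α * (2 + δ * R) :=
    (div_le_iff₀ (by positivity)).1 (le_max_right _ _)
  set C := (1 + K) * (D * (2 + δ)) with hC
  have hC0 : 0 < C := by positivity
  set L := C / α + N / (1 - α) + 2 with hL
  have hN' : (0 : ℝ) < N := by exact_mod_cast hN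
  have hL1 : C / α ≤ L := by
    have : 0 ≤ N / (1 - α) := by positivity
    rw [hL]; linarith
  have hL2 : N / (1 - α) ≤ L := by
    have : 0 ≤ C / α := by positivity
    rw [hL]; linarith
  have hL3 : 2 ≤ L := by
    have : 0 ≤ C / α := by positivity
    have : 0 ≤ N / (1 - α) := by positivity
    rw [hL]; linarith
  have hL0 : 0 < L := by linarith
  have hr0 : 0 ≤ 1 - L⁻¹ := by
    have : L⁻¹ ≤ 1 := inv_le_one_of_one_le₀ (by linarith)
    linarith
  have hr1 : 1 - L⁻¹ ≤ 1 := by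
    have : 0 < L⁻¹ := by positivity
    linarith
  have hαN : α ≤ (1 - L⁻¹) ^ N := by
    have h1 : 1 + (N : ℝ) * (-L⁻¹) ≤ (1 + -L⁻¹) ^ N :=
      one_add_mul_le_pow (by linarith) N
    have h2 : (N : ℝ) * L⁻¹ ≤ 1 - α := by
      rw [← div_eq_mul_inv, div_le_iff₀ hL0]
      rw [div_le_iff₀ hα1'] at hL2
      linarith
    rw [← sub_eq_add_neg] at h1
    linarith
  have hrate : ∀ n : ℕ, C * α ^ (n / N) ≤ L * (1 - L⁻¹) ^ n := fun n => by
    have h1 : α ^ (n / N + 1) ≤ (1 - L⁻¹) ^ n := by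
      calc α ^ (n / N + 1) ≤ ((1 - L⁻¹) ^ N) ^ (n / N + 1) := by gcongr
        _ = (1 - L⁻¹) ^ (N * (n / N + 1)) := by rw [pow_mul]
        _ ≤ (1 - L⁻¹) ^ n := by
          refine pow_le_pow_of_le_one hr0 hr1 ?_
          rw [mul_comm]
          exact (Nat.lt_div_mul_add hN).le.trans (by rw [add_mul, one_mul])
    calc C * α ^ (n / N) = C / α * α ^ (n / N + 1) := by
          rw [pow_succ]; field_simp
      _ ≤ L * (1 - L⁻¹) ^ n := by gcongr
  refine ⟨L, by linarith, ?_⟩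
  intro V hVm hV1 κ hκ hint hdrift ⟨ν, hνf, hνc, hmin⟩ f hf hfV n
  have hm := isMarkovKernel_pow κ
  have hV0 : ∀ x, 0 ≤ V x := fun x => zero_le_one.trans (hV1 x)
  have hpow : ∀ n x, Integrable V ((κ ^ n) x) ∧ ∫ z, V z ∂(κ ^ n) x ≤ β ^ n * V x + K := by
    intro n x
    obtain ⟨h1, h2⟩ := drift_pow hVm hV0 hβ hint hdrift n x
    refine ⟨h1, h2.trans ?_⟩
    have : 0 ≤ β ^ n := by positivity
    nlinarith
  have hfi : ∀ n x, Integrable f ((κ ^ n) x) := fun n x =>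
    (hpow n x).1.mono' hf.aestronglyMeasurable (ae_of_all _ hfV)
  set r := n % N
  set q := n / N
  set φ : E → ℝ := fun x => ∫ z, f z ∂(κ ^ r) x with hφ
  have hφm : Measurable φ := (hf.stronglyMeasurable.integral_kernel).measurable
  have hφV : ∀ x, |φ x| ≤ V x + K := fun x => by
    calc |φ x| ≤ ∫ z, |f z| ∂(κ ^ r) x := abs_integral_le_integral_abs
      _ ≤ ∫ z, V z ∂(κ ^ r) x := integral_mono (hfi r x).abs (hpow r x).1 hfV
      _ ≤ β ^ r * V x + K := (hpow r x).2
      _ ≤ V x + K := by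
        have : β ^ r ≤ 1 := pow_le_one₀ hβ0.le hβ.2.le
        nlinarith [hV0 x]
  have hosc : ∀ x y, φ x - φ y ≤ D * (2 + δ * V x + δ * V y) := fun x y => by
    have h1 := (abs_le.1 (hφV x)).2
    have h2 := (abs_le.1 (hφV y)).1
    have h3 : δ⁻¹ * δ = 1 := inv_mul_cancel₀ hδ0.ne'
    have h4 : δ⁻¹ * (2 + δ * V x + δ * V y) = 2 * δ⁻¹ + V x + V y := by
      linear_combination (V x + V y) * h3
    have h5 : 0 < δ⁻¹ := by positivity
    have h6 : 0 ≤ K * (δ * V x + δ * V y) := by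
      have := hV0 x
      have := hV0 y
      positivity
    rw [hD, add_mul, h4]
    linarith
  have e : κ ^ n = (κ ^ r) ∘ₖ ((κ ^ N) ^ q) := by
    rw [← pow_mul]
    change _ = κ ^ r * κ ^ (N * q)
    rw [← pow_add, Nat.mod_add_div]
  have eφ : ∀ x, ∫ z, f z ∂(κ ^ n) x = ∫ z, φ z ∂((κ ^ N) ^ q) x := fun x => by
    have := hfi n x
    rw [e] at this ⊢
    rw [Kernel.integral_comp this]
  have hdec : ∀ x y, φ x - φ y ≤ D * (2 + δ * V x + δ * V y) →
      ∫ z, φ z ∂((κ ^ N) ^ q) x - ∫ z, φ z ∂((κ ^ N) ^ q) y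
        ≤ α ^ q * D * (2 + δ * V x + δ * V y) := fun x y _ => by
    refine oscillation_pow_le (W := fun x y => 2 + δ * V x + δ * V y) hα0.le
      (fun φ hφ D hD h n x => ?_) (fun φ hφ D hD h x y => ?_) hφm hD0.le hosc q x y
    · rw [← pow_mul]
      have i := (hpow (N * n) x).1
      have i2 : Integrable (fun z => |φ x| + D * (2 + δ * V z + δ * V x)) ((κ ^ (N * n)) x) := by
        refine (integrable_const _).add (Integrable.const_mul ?_ _)
        exact ((integrable_const _).add (i.const_mul δ)).add (integrable_const _)
      refine i2.mono' hφ.aestronglyMeasurable (ae_of_all _ fun z => ?_)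
      have h1 := h z x
      have h2 := h x z
      rw [Real.norm_eq_abs]
      refine abs_le.2 ⟨?_, ?_⟩
      · nlinarith [neg_abs_le (φ x)]
      · nlinarith [le_abs_self (φ x)]
    · refine harris_contraction (V := V) (γ := β) (K := K) (R := R) (c := c) (ν := ν) hV0
        (fun x => (hpow N x).1) (fun x => (hpow N x).2.trans ?_) hδ0 ?_ hνc hmin
        ((le_max_right _ _).trans (le_max_left _ _)) hαβ hα3 hφ hD h x y
      · have : β ^ N ≤ β := by
          simpa using pow_le_pow_of_le_one hβ0.le hβ.2.le hN
        nlinarith [hV0 x]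
      · rw [hδ]
        refine le_of_eq ?_
        field_simp
  intro x y
  have habs : |∫ z, f z ∂(κ ^ n) x - ∫ z, f z ∂(κ ^ n) y|
      ≤ α ^ q * D * (2 + δ * V x + δ * V y) := by
    rw [eφ, eφ, abs_le]
    have h1 := hdec x y (hosc x y)
    have h2 := hdec y x (hosc y x)
    constructor <;> linarith
  calc (1 + K) * |∫ z, f z ∂(κ ^ n) x - ∫ z, f z ∂(κ ^ n) y|
      ≤ (1 + K) * (α ^ q * D * (2 + δ * V x + δ * V y)) := by gcongr
    _ ≤ (1 + K) * (α ^ q * D * ((2 + δ) * (V x + V y))) := by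
        gcongr
        nlinarith [hV1 x, hV1 y]
    _ = C * α ^ q * (V x + V y) := by rw [hC]; ring
    _ ≤ L * (1 - L⁻¹) ^ n * (V x + V y) := by
        have := hV0 x
        have := hV0 y
        have := hrate n
        gcongr

/-- **Harris' theorem** with constants depending only on the drift and minorization parameters. -/
theorem harris_theorem [Nonempty E] {β b R c : ℝ} (hβ : β ∈ Ioo (0 : ℝ) 1)
    (hb : 0 < b) (hR : 2 * (b / (1 - β)) < (1 - β) * R) (hc : 0 < c) {N : ℕ} (hN : 0 < N) :
    ∃ L > (1 : ℝ), ∀ V : E → ℝ, Measurable V → (∀ x, 1 ≤ V x) →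
      ∀ κ : Kernel E E, IsMarkovKernel κ →
      (∀ x, Integrable V (κ x)) → (∀ x, ∫ z, V z ∂κ x ≤ β * V x + b) →
      (∃ ν : Measure E, IsFiniteMeasure ν ∧ ν.real univ = c ∧ ∀ x, V x ≤ R → ν ≤ (κ ^ N) x) →
      ∃ π : Measure E, IsProbabilityMeasure π ∧ κ.Invariant π ∧
        (∀ π' : Measure E, IsProbabilityMeasure π' → κ.Invariant π' → π' = π) ∧
        ∫ x, V x ∂π ≤ b / (1 - β) ∧
        ∀ (n : ℕ) (x : E) (f : E → ℝ), Measurable f → (∀ x, |f x| ≤ V x) →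
          |∫ z, f z ∂(κ ^ n) x - ∫ z, f z ∂π| ≤ L * (1 - L⁻¹) ^ n * V x := by
  obtain ⟨L, hL, H⟩ := exists_oscillation_decay (E := E) hβ hb hR hc hN
  refine ⟨L, hL, fun V hVm hV1 κ hκ hint hdrift hmin => ?_⟩
  have hm := isMarkovKernel_pow κ
  have hV0 : ∀ x, 0 ≤ V x := fun x => zero_le_one.trans (hV1 x)
  have hosc := H V hVm hV1 κ hκ hint hdrift hmin
  set K := b / (1 - β) with hK
  have hK0 : 0 < K := div_pos hb (by linarith [hβ.2])
  have hLi : 0 < L⁻¹ := by positivity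
  have hLi1 : L⁻¹ < 1 := inv_lt_one_of_one_lt₀ hL
  have hpow : ∀ n x, Integrable V ((κ ^ n) x) ∧ ∫ z, V z ∂(κ ^ n) x ≤ V x + K := by
    intro n x
    obtain ⟨h1, h2⟩ := drift_pow hVm hV0 hβ hint hdrift n x
    refine ⟨h1, h2.trans ?_⟩
    have := hβ.1
    have : 0 ≤ β ^ n := by positivity
    have : β ^ n ≤ 1 := pow_le_one₀ hβ.1.le hβ.2.le
    nlinarith [hV0 x]
  have hfi : ∀ f : E → ℝ, Measurable f → (∀ x, |f x| ≤ V x) → ∀ n x, Integrable f ((κ ^ n) x) :=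
    fun f hf hfV n x => (hpow n x).1.mono' hf.aestronglyMeasurable (ae_of_all _ hfV)
  have hconst : ∀ (μ : Measure E) [IsProbabilityMeasure μ] (n : ℕ) (x : E), Integrable V μ →
      ∀ f : E → ℝ, Measurable f → (∀ x, |f x| ≤ V x) →
      (1 + K) * |∫ z, f z ∂(κ ^ n) x - ∫ y, ∫ z, f z ∂(κ ^ n) y ∂μ|
        ≤ L * (1 - L⁻¹) ^ n * (V x + ∫ y, V y ∂μ) := by
    intro μ _ n x hVμ f hf hfV
    have i1 : Integrable (fun y => ∫ z, f z ∂(κ ^ n) y) μ := by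
      refine (hVμ.add (integrable_const K)).mono'
        (hf.stronglyMeasurable.integral_kernel).aestronglyMeasurable (ae_of_all _ fun y => ?_)
      calc |∫ z, f z ∂(κ ^ n) y| ≤ ∫ z, |f z| ∂(κ ^ n) y := abs_integral_le_integral_abs
        _ ≤ ∫ z, V z ∂(κ ^ n) y := integral_mono (hfi f hf hfV n y).abs (hpow n y).1 hfV
        _ ≤ V y + K := (hpow n y).2
    have e1 : ∫ z, f z ∂(κ ^ n) x - ∫ y, ∫ z, f z ∂(κ ^ n) y ∂μ
        = ∫ y, (∫ z, f z ∂(κ ^ n) x - ∫ z, f z ∂(κ ^ n) y) ∂μ := by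
      rw [integral_sub (integrable_const _) i1]; simp
    have i2 : Integrable (fun y => L * (1 - L⁻¹) ^ n * (V x + V y)) μ :=
      ((integrable_const _).add hVμ).const_mul _
    rw [e1]
    calc (1 + K) * |∫ y, (∫ z, f z ∂(κ ^ n) x - ∫ z, f z ∂(κ ^ n) y) ∂μ|
        ≤ (1 + K) * ∫ y, |∫ z, f z ∂(κ ^ n) x - ∫ z, f z ∂(κ ^ n) y| ∂μ := by
          gcongr
          exact abs_integral_le_integral_abs
      _ = ∫ y, (1 + K) * |∫ z, f z ∂(κ ^ n) x - ∫ z, f z ∂(κ ^ n) y| ∂μ :=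
          (integral_const_mul _ _).symm
      _ ≤ ∫ y, L * (1 - L⁻¹) ^ n * (V x + V y) ∂μ :=
          integral_mono (((integrable_const _).sub i1).abs.const_mul _) i2 fun y =>
            hosc f hf hfV n x y
      _ = L * (1 - L⁻¹) ^ n * (V x + ∫ y, V y ∂μ) := by
          rw [integral_const_mul, integral_add (integrable_const _) hVμ]; simp
  have hconv : ∀ π : Measure E, IsProbabilityMeasure π → κ.Invariant π →
      ∀ (n : ℕ) (x : E) (f : E → ℝ), Measurable f → (∀ x, |f x| ≤ V x) →
        |∫ z, f z ∂(κ ^ n) x - ∫ z, f z ∂π| ≤ L * (1 - L⁻¹) ^ n * V x := by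
    intro π _ hπ n x f hf hfV
    obtain ⟨hVπ, hVπK⟩ := integrable_of_invariant_of_drift hVm hV0 hβ hb hint hdrift hπ
    have h1 := hconst π n x hVπ f hf hfV
    rw [← integral_of_invariant (invariant_pow hπ n)
      (hVπ.mono' hf.aestronglyMeasurable (ae_of_all _ hfV))] at h1
    have h2 : L * (1 - L⁻¹) ^ n * (V x + ∫ y, V y ∂π)
        ≤ L * (1 - L⁻¹) ^ n * ((1 + K) * V x) := by
      have : 0 ≤ 1 - L⁻¹ := by linarith
      gcongr
      nlinarith [hV1 x]
    have h3 : (0 : ℝ) < 1 + K := by linarith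
    refine le_of_mul_le_mul_left ?_ h3
    linarith
  have hind : ∀ A : Set E, MeasurableSet A → Measurable (A.indicator fun _ => (1 : ℝ)) ∧
      (∀ x, |A.indicator (fun _ => (1 : ℝ)) x| ≤ V x) := fun A hA => by
    refine ⟨measurable_const.indicator hA, fun x => le_trans ?_ (hV1 x)⟩
    by_cases hx : x ∈ A <;> simp [hx]
  have hrate : Tendsto (fun n : ℕ => L * (1 - L⁻¹) ^ n) atTop (𝓝 0) := by
    simpa using (tendsto_pow_atTop_nhds_zero_of_lt_one (r := 1 - L⁻¹) (by linarith)
      (by linarith)).const_mul L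
  obtain ⟨x₀⟩ := ‹Nonempty E›
  obtain ⟨π, hπ, hlim⟩ := exists_setwise_limit (μ := fun n => (κ ^ n) x₀)
    (ε := fun n => L * (1 - L⁻¹) ^ n * (V x₀ + (V x₀ + K)))
    (by simpa using hrate.mul_const (V x₀ + (V x₀ + K)))
    (fun n k A hA => by
      obtain ⟨hf, hfV⟩ := hind A hA
      have h1 := hconst ((κ ^ k) x₀) n x₀ (hpow k x₀).1 _ hf hfV
      have e : κ ^ (n + k) = (κ ^ n) ∘ₖ (κ ^ k) := pow_add κ n k
      have i := hfi _ hf hfV (n + k) x₀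
      rw [e] at i
      rw [← Kernel.integral_comp i, ← e, integral_indicator_const _ hA,
        integral_indicator_const _ hA, smul_eq_mul, mul_one, smul_eq_mul, mul_one,
        abs_sub_comm] at h1
      have h2 : |((κ ^ (n + k)) x₀).real A - ((κ ^ n) x₀).real A|
          ≤ (1 + K) * |((κ ^ (n + k)) x₀).real A - ((κ ^ n) x₀).real A| :=
        le_mul_of_one_le_left (abs_nonneg _) (by linarith)
      refine h2.trans (h1.trans ?_)
      have : 0 ≤ 1 - L⁻¹ := by linarith
      have := (hpow k x₀).2
      gcongr)
  have hinv : κ.Invariant π := by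
    change π.bind κ = π
    have : IsProbabilityMeasure (π.bind κ) := inferInstance
    refine Measure.ext fun A hA => ?_
    rw [← measureReal_eq_measureReal_iff, measureReal_bind κ hA]
    refine tendsto_nhds_unique (tendsto_integral_of_setwise hlim
      (κ.measurable_coe hA).ennreal_toReal (fun x => measureReal_nonneg)
      fun x => measureReal_le_one) ?_
    refine ((tendsto_add_atTop_iff_nat 1).2 (hlim A hA)).congr fun n => ?_
    have e : (κ ^ (n + 1)) x₀ = ((κ ^ n) x₀).bind κ := by
      rw [pow_succ']; exact Kernel.comp_apply _ _ _
    simp only [e, measureReal_bind κ hA]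
  refine ⟨π, hπ, hinv, fun π' hπ' hinv' => ?_,
    (integrable_of_invariant_of_drift hVm hV0 hβ hb hint hdrift hinv).2, hconv π hπ hinv⟩
  refine Measure.ext fun A hA => ?_
  rw [← measureReal_eq_measureReal_iff]
  refine tendsto_nhds_unique ?_ (hlim A hA)
  obtain ⟨hf, hfV⟩ := hind A hA
  rw [tendsto_iff_dist_tendsto_zero]
  refine squeeze_zero (fun _ => dist_nonneg) (fun n => ?_)
    (by simpa using hrate.mul_const (V x₀))
  have := hconv π' hπ' hinv' n x₀ _ hf hfV
  rwa [integral_indicator_const _ hA, integral_indicator_const _ hA, smul_eq_mul, mul_one,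
    smul_eq_mul, mul_one] at this

end HarrisTheorem

section CarKernel

variable {d : ℕ} {ρ : ℝ} {Γ : Measure (Ed d)} {g : Ed d → Ed d → ℝ}

/-- The law of the state after one step of the chain started at `Λ`. -/
def carMeasure (d : ℕ) (ρ : ℝ) (Γ : Measure (Ed d)) (g : Ed d → Ed d → ℝ) (Λ : Ed d) :
    Measure (Ed d) :=
  (Γ.withDensity fun X => ENNReal.ofReal (g Λ X)).map (fun X => Λ + (1 - ρ) • X) +
    (Γ.withDensity fun X => ENNReal.ofReal (1 - g Λ X)).map (fun X => Λ - ρ • X)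

lemma lintegral_carMeasure (hg : Measurable (Function.uncurry g)) {h : Ed d → ℝ≥0∞}
    (hh : Measurable h) (Λ : Ed d) :
    ∫⁻ x, h x ∂carMeasure d ρ Γ g Λ =
      ∫⁻ X, ENNReal.ofReal (g Λ X) * h (Λ + (1 - ρ) • X) +
        ENNReal.ofReal (1 - g Λ X) * h (Λ - ρ • X) ∂Γ := by
  have hgΛ : Measurable (g Λ) := hg.of_uncurry_left
  rw [carMeasure, lintegral_add_measure, lintegral_map hh (by fun_prop),
    lintegral_map hh (by fun_prop), lintegral_withDensity_eq_lintegral_mul _ (by fun_prop)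
      (by fun_prop), lintegral_withDensity_eq_lintegral_mul _ (by fun_prop)
      (by fun_prop), ← lintegral_add_left (by simp only [Pi.mul_def]; fun_prop)]
  rfl

lemma measurable_carMeasure [SFinite Γ] (hg : Measurable (Function.uncurry g)) :
    Measurable (carMeasure d ρ Γ g) := by
  refine Measure.measurable_of_measurable_coe _ fun A hA => ?_
  have hi : Measurable (A.indicator (1 : Ed d → ℝ≥0∞)) := measurable_one.indicator hA
  have e : ∀ Λ, carMeasure d ρ Γ g Λ A = _ := fun Λ => by
    rw [← lintegral_indicator_one hA, lintegral_carMeasure hg hi]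
  simp_rw [e]
  refine Measurable.lintegral_prod_right' (f := fun p : Ed d × Ed d =>
    ENNReal.ofReal (Function.uncurry g p) * A.indicator 1 (p.1 + (1 - ρ) • p.2) +
      ENNReal.ofReal (1 - Function.uncurry g p) * A.indicator 1 (p.1 - ρ • p.2)) ?_
  fun_prop

/-- The transition kernel of the chain. -/
def carKernel (d : ℕ) (ρ : ℝ) (Γ : Measure (Ed d)) [SFinite Γ] (g : Ed d → Ed d → ℝ)
    (hg : Measurable (Function.uncurry g)) : Kernel (Ed d) (Ed d) :=
  ⟨carMeasure d ρ Γ g, measurable_carMeasure hg⟩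

lemma carKernel_apply [SFinite Γ] (hg : Measurable (Function.uncurry g)) (Λ : Ed d) :
    carKernel d ρ Γ g hg Λ = carMeasure d ρ Γ g Λ := rfl

lemma isMarkovKernel_carKernel [IsProbabilityMeasure Γ] (hg : Measurable (Function.uncurry g))
    (h01 : ∀ Λ X, g Λ X ∈ Icc (0 : ℝ) 1) : IsMarkovKernel (carKernel d ρ Γ g hg) := by
  refine ⟨fun Λ => ⟨?_⟩⟩
  rw [carKernel_apply, ← lintegral_one, lintegral_carMeasure hg measurable_const]
  simp_rw [mul_one]
  have : ∀ X, ENNReal.ofReal (g Λ X) + ENNReal.ofReal (1 - g Λ X) = 1 := fun X => by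
    rw [← ENNReal.ofReal_add (h01 Λ X).1 (by linarith [(h01 Λ X).2])]
    simp
  simp [this]

lemma integral_carMeasure (hg : Measurable (Function.uncurry g))
    (h01 : ∀ Λ X, g Λ X ∈ Icc (0 : ℝ) 1) {f : Ed d → ℝ} (hf : Measurable f) {Λ : Ed d}
    (hi : Integrable f (carMeasure d ρ Γ g Λ)) :
    ∫ x, f x ∂carMeasure d ρ Γ g Λ = kernelOp d ρ Γ g f Λ := by
  have hgΛ : Measurable (g Λ) := hg.of_uncurry_left
  have t1 : ∀ X, (ENNReal.ofReal (g Λ X)).toReal = g Λ X := fun X =>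
    ENNReal.toReal_ofReal (h01 Λ X).1
  have t2 : ∀ X, (ENNReal.ofReal (1 - g Λ X)).toReal = 1 - g Λ X := fun X =>
    ENNReal.toReal_ofReal (by linarith [(h01 Λ X).2])
  have hi1 := hi.left_of_add_measure
  have hi2 := hi.right_of_add_measure
  have i1 := (integrable_withDensity_iff_integrable_smul' (by fun_prop)
    (ae_of_all _ fun X => ENNReal.ofReal_lt_top)).1
    ((integrable_map_measure hf.aestronglyMeasurable (by fun_prop)).1 hi1)
  have i2 := (integrable_withDensity_iff_integrable_smul' (by fun_prop)
    (ae_of_all _ fun X => ENNReal.ofReal_lt_top)).1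
    ((integrable_map_measure hf.aestronglyMeasurable (by fun_prop)).1 hi2)
  rw [carMeasure, integral_add_measure hi1 hi2,
    integral_map (by fun_prop) hf.aestronglyMeasurable,
    integral_map (by fun_prop) hf.aestronglyMeasurable,
    integral_withDensity_eq_integral_toReal_smul (by fun_prop)
      (ae_of_all _ fun X => ENNReal.ofReal_lt_top),
    integral_withDensity_eq_integral_toReal_smul (by fun_prop)
      (ae_of_all _ fun X => ENNReal.ofReal_lt_top)]
  refine (integral_add i1 i2).symm.trans ?_
  simp only [t1, t2, smul_eq_mul, Function.comp_apply, kernelOp]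

lemma iterate_kernelOp_eq [IsProbabilityMeasure Γ] (hg : Measurable (Function.uncurry g))
    (h01 : ∀ Λ X, g Λ X ∈ Icc (0 : ℝ) 1) {f : Ed d → ℝ} (hf : Measurable f)
    (hi : ∀ n Λ, Integrable f ((carKernel d ρ Γ g hg ^ n) Λ)) (n : ℕ) (Λ : Ed d) :
    (kernelOp d ρ Γ g)^[n] f Λ = ∫ x, f x ∂(carKernel d ρ Γ g hg ^ n) Λ := by
  have hM := isMarkovKernel_carKernel (ρ := ρ) (Γ := Γ) hg h01
  have hm := isMarkovKernel_pow (carKernel d ρ Γ g hg)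
  induction n generalizing Λ with
  | zero =>
    have h : (carKernel d ρ Γ g hg ^ 0) Λ = Measure.dirac Λ := by
      rw [pow_zero]; exact Kernel.id_apply Λ
    rw [h, integral_dirac' _ _ hf.stronglyMeasurable]
    rfl
  | succ n ih =>
    have e : carKernel d ρ Γ g hg ^ (n + 1) =
        (carKernel d ρ Γ g hg ^ n) ∘ₖ carKernel d ρ Γ g hg := pow_succ _ _
    have i := hi (n + 1) Λ
    rw [e] at i ⊢
    rw [Function.iterate_succ_apply', Kernel.integral_comp i, funext ih, carKernel_apply,
      integral_carMeasure hg h01 _ _]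
    · exact (hf.stronglyMeasurable.integral_kernel).measurable
    · exact i.integral_comp

lemma isInvariantMeasure_iff [IsProbabilityMeasure Γ] (hg : Measurable (Function.uncurry g))
    (h01 : ∀ Λ X, g Λ X ∈ Icc (0 : ℝ) 1) (π : Measure (Ed d)) [IsProbabilityMeasure π] :
    IsInvariantMeasure d ρ Γ g π ↔ (carKernel d ρ Γ g hg).Invariant π := by
  have hM := isMarkovKernel_carKernel (ρ := ρ) (Γ := Γ) hg h01
  have key : ∀ A, MeasurableSet A →
      ∫ Λ, kernelOp d ρ Γ g (A.indicator fun _ => (1 : ℝ)) Λ ∂π =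
        (π.bind (carKernel d ρ Γ g hg)).real A := fun A hA => by
    rw [measureReal_bind _ hA]
    congr 1 with Λ
    have hm : Measurable (A.indicator fun _ => (1 : ℝ)) := measurable_const.indicator hA
    rw [← integral_carMeasure hg h01 hm, integral_indicator_const _ hA, smul_eq_mul, mul_one]
    · rfl
    · rw [← carKernel_apply hg]
      exact (integrable_const _).indicator hA
  have : IsProbabilityMeasure (π.bind (carKernel d ρ Γ g hg)) := inferInstance
  constructor
  · intro h
    refine Measure.ext fun A hA => ?_
    rw [← measureReal_eq_measureReal_iff, ← key A hA]
    exact (h A hA).symm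
  · intro h A hA
    rw [key A hA, h]
    rfl

end CarKernel

section ConvPow

variable {d : ℕ} {ρ ι : ℝ} {Γ μ : Measure (Ed d)} {g : Ed d → Ed d → ℝ}

lemma lintegral_mixMeasure {h : Ed d → ℝ≥0∞} (hh : Measurable h) :
    ∫⁻ x, h x ∂mixMeasure d ρ Γ =
      ENNReal.ofReal ρ * ∫⁻ X, h ((1 - ρ) • X) ∂Γ +
        ENNReal.ofReal (1 - ρ) * ∫⁻ X, h ((-ρ) • X) ∂Γ := by
  rw [mixMeasure, lintegral_add_measure, lintegral_smul_measure, lintegral_smul_measure,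
    lintegral_map hh (by fun_prop), lintegral_map hh (by fun_prop)]
  rfl

lemma isProbabilityMeasure_mixMeasure [IsProbabilityMeasure Γ] (hρ : ρ ∈ Ioo (0 : ℝ) 1) :
    IsProbabilityMeasure (mixMeasure d ρ Γ) := by
  refine ⟨?_⟩
  rw [← lintegral_one, lintegral_mixMeasure measurable_const]
  simp only [lintegral_one, measure_univ, mul_one]
  rw [← ENNReal.ofReal_add hρ.1.le (by linarith [hρ.2])]
  simp

lemma isProbabilityMeasure_convPow [IsProbabilityMeasure μ] (n : ℕ) :
    IsProbabilityMeasure (convPow d μ n) := by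
  induction n with
  | zero => exact inferInstanceAs (IsProbabilityMeasure (Measure.dirac 0))
  | succ n ih => exact Measure.isProbabilityMeasure_map (by fun_prop)

lemma convPow_succ (n : ℕ) : convPow d μ (n + 1) = Measure.conv (convPow d μ n) μ := rfl

lemma convPow_add [IsProbabilityMeasure μ] (m n : ℕ) :
    convPow d μ (m + n) = Measure.conv (convPow d μ m) (convPow d μ n) := by
  have hp := isProbabilityMeasure_convPow (μ := μ)
  induction n with
  | zero => exact (Measure.conv_dirac_zero _).symm
  | succ n ih => rw [← add_assoc, convPow_succ, ih, convPow_succ, Measure.conv_assoc]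

lemma le_lintegral_carMeasure (hg : Measurable (Function.uncurry g)) (hρ : ρ ∈ Ioo (0 : ℝ) 1)
    (hι : 0 ≤ ι) (hgι : ∀ Λ X, g Λ X ∈ Icc ι (1 - ι)) {h : Ed d → ℝ≥0∞} (hh : Measurable h)
    (Λ : Ed d) :
    ENNReal.ofReal ι * ∫⁻ y, h (Λ + y) ∂mixMeasure d ρ Γ ≤
      ∫⁻ x, h x ∂carMeasure d ρ Γ g Λ := by
  rw [lintegral_mixMeasure (by fun_prop), lintegral_carMeasure hg hh,
    ← lintegral_const_mul _ (by fun_prop), ← lintegral_const_mul _ (by fun_prop),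
    ← lintegral_add_left (by fun_prop), ← lintegral_const_mul _ (by fun_prop)]
  refine lintegral_mono fun X => ?_
  have h1 : ENNReal.ofReal ι * ENNReal.ofReal ρ ≤ ENNReal.ofReal (g Λ X) := by
    rw [← ENNReal.ofReal_mul hι]
    exact ENNReal.ofReal_le_ofReal (by nlinarith [(hgι Λ X).1, hρ.2])
  have h2 : ENNReal.ofReal ι * ENNReal.ofReal (1 - ρ) ≤ ENNReal.ofReal (1 - g Λ X) := by
    rw [← ENNReal.ofReal_mul hι]
    exact ENNReal.ofReal_le_ofReal (by nlinarith [(hgι Λ X).2, hρ.1])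
  have e : Λ + (-ρ) • X = Λ - ρ • X := by rw [neg_smul, sub_eq_add_neg]
  simp only [e]
  rw [mul_add, ← mul_assoc, ← mul_assoc]
  gcongr

lemma le_lintegral_carKernel_pow [IsProbabilityMeasure Γ] (hg : Measurable (Function.uncurry g))
    (hρ : ρ ∈ Ioo (0 : ℝ) 1) (hι : 0 ≤ ι) (hgι : ∀ Λ X, g Λ X ∈ Icc ι (1 - ι)) (n : ℕ)
    {h : Ed d → ℝ≥0∞} (hh : Measurable h) (Λ : Ed d) :
    ENNReal.ofReal ι ^ n * ∫⁻ y, h (Λ + y) ∂convPow d (mixMeasure d ρ Γ) n ≤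
      ∫⁻ x, h x ∂(carKernel d ρ Γ g hg ^ n) Λ := by
  have hp := isProbabilityMeasure_mixMeasure (Γ := Γ) hρ
  have hM := isMarkovKernel_carKernel (ρ := ρ) (Γ := Γ) hg fun Λ X =>
    ⟨hι.trans (hgι Λ X).1, (hgι Λ X).2.trans (by linarith)⟩
  have hm := isMarkovKernel_pow (carKernel d ρ Γ g hg)
  have hpc := isProbabilityMeasure_convPow (μ := mixMeasure d ρ Γ)
  induction n generalizing h with
  | zero =>
    have e : (carKernel d ρ Γ g hg ^ 0) Λ = Measure.dirac Λ := by
      rw [pow_zero]; exact Kernel.id_apply Λ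
    rw [e, lintegral_dirac' _ hh, convPow, lintegral_dirac' _ (by fun_prop)]
    simp
  | succ n ih =>
    have e : carKernel d ρ Γ g hg ^ (n + 1) =
        carKernel d ρ Γ g hg ∘ₖ (carKernel d ρ Γ g hg ^ n) := pow_succ' _ _
    have hJ : Measurable fun z => ∫⁻ y, h (z + y) ∂mixMeasure d ρ Γ :=
      Measurable.lintegral_prod_right' (f := fun p : Ed d × Ed d => h (p.1 + p.2)) (by fun_prop)
    rw [e, Kernel.lintegral_comp _ _ _ hh, convPow_succ, Measure.lintegral_conv (by fun_prop)]
    calc ENNReal.ofReal ι ^ (n + 1) *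
          ∫⁻ x, ∫⁻ y, h (Λ + (x + y)) ∂mixMeasure d ρ Γ ∂convPow d (mixMeasure d ρ Γ) n
        = ENNReal.ofReal ι * (ENNReal.ofReal ι ^ n * ∫⁻ x, (fun z => ∫⁻ y, h (z + y)
            ∂mixMeasure d ρ Γ) (Λ + x) ∂convPow d (mixMeasure d ρ Γ) n) := by
          rw [pow_succ', mul_assoc]
          simp only [add_assoc]
      _ ≤ ENNReal.ofReal ι * ∫⁻ z, ∫⁻ y, h (z + y) ∂mixMeasure d ρ Γ
            ∂(carKernel d ρ Γ g hg ^ n) Λ := by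
          gcongr
          exact ih hJ
      _ ≤ _ := by
          rw [← lintegral_const_mul _ hJ]
          exact lintegral_mono fun z => le_lintegral_carMeasure hg hρ hι hgι hh z

lemma ae_convPow_mem_submodule [IsProbabilityMeasure μ] (W : Submodule ℝ (Ed d))
    (h : ∀ᵐ x ∂μ, x ∈ W) (n : ℕ) : ∀ᵐ x ∂convPow d μ n, x ∈ W := by
  have hp := isProbabilityMeasure_convPow (μ := μ)
  have hW : MeasurableSet {x | x ∈ W} := W.closed_of_finiteDimensional.measurableSet
  induction n with
  | zero => exact (ae_dirac_iff hW).2 W.zero_mem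
  | succ n ih =>
    refine (ae_map_iff (by fun_prop) hW).2 ?_
    filter_upwards [Measure.quasiMeasurePreserving_fst.ae ih,
      Measure.quasiMeasurePreserving_snd.ae h] with p h1 h2 using W.add_mem h1 h2

end ConvPow

section BallMinorization

open scoped Topology Pointwise

variable {d : ℕ} {μ μ₁ μ₂ : Measure (Ed d)}

lemma smul_restrict_le_conv [SFinite μ₁] [SFinite μ₂] {A G : Set (Ed d)} (hA : MeasurableSet A)
    (hG : MeasurableSet G) {c c' : ℝ≥0∞} (h₁ : c • volume.restrict A ≤ μ₁)
    (h₂ : ∀ z ∈ G, c' ≤ μ₂ {y | z - y ∈ A}) :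
    (c * c') • volume.restrict G ≤ Measure.conv μ₁ μ₂ := by
  rw [Measure.conv_comm]
  refine Measure.le_iff.2 fun s hs => ?_
  have hm : Measurable fun p : Ed d × Ed d =>
      A.indicator (1 : Ed d → ℝ≥0∞) (p.2 - p.1) * s.indicator 1 p.2 :=
    ((measurable_one.indicator hA).comp (measurable_snd.sub measurable_fst)).mul
      ((measurable_one.indicator hs).comp measurable_snd)
  have hinner : ∀ y, c * ∫⁻ z, A.indicator (1 : Ed d → ℝ≥0∞) (z - y) * s.indicator 1 z ≤
      ∫⁻ x, s.indicator 1 (y + x) ∂μ₁ := fun y => by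
    calc c * ∫⁻ z, A.indicator (1 : Ed d → ℝ≥0∞) (z - y) * s.indicator 1 z
        = c * ∫⁻ x, A.indicator (1 : Ed d → ℝ≥0∞) x * s.indicator 1 (y + x) := by
          rw [← lintegral_add_left_eq_self (μ := volume) _ y]
          simp
      _ = ∫⁻ x, s.indicator 1 (y + x) ∂(c • volume.restrict A) := by
          rw [lintegral_smul_measure, ← lintegral_indicator hA, smul_eq_mul]
          congr 2 with x
          by_cases hx : x ∈ A <;> simp [hx]
      _ ≤ _ := lintegral_mono' h₁ le_rfl
  have hsG : Measurable ((s ∩ G).indicator (1 : Ed d → ℝ≥0∞)) :=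
    measurable_one.indicator (hs.inter hG)
  have hpt : ∀ z, c' * (s ∩ G).indicator (1 : Ed d → ℝ≥0∞) z ≤
      ∫⁻ y, A.indicator (1 : Ed d → ℝ≥0∞) (z - y) * s.indicator 1 z ∂μ₂ := fun z => by
    by_cases hz : z ∈ s ∩ G
    · have hA' : MeasurableSet {y | z - y ∈ A} := hA.preimage (by fun_prop)
      have e : ∀ y, A.indicator (1 : Ed d → ℝ≥0∞) (z - y) * s.indicator 1 z =
          {y | z - y ∈ A}.indicator 1 y := fun y => by
        by_cases hy : z - y ∈ A <;> simp [hy, hz.1]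
      simp_rw [e]
      rw [lintegral_indicator_one hA', indicator_of_mem hz]
      simpa using h₂ z hz.2
    · simp [indicator_of_notMem hz]
  calc ((c * c') • volume.restrict G) s
      = c * ∫⁻ z, c' * (s ∩ G).indicator 1 z := by
        rw [lintegral_const_mul _ hsG, lintegral_indicator_one (hs.inter hG), Measure.smul_apply,
          Measure.restrict_apply hs, smul_eq_mul, mul_assoc]
    _ ≤ c * ∫⁻ z, ∫⁻ y, A.indicator (1 : Ed d → ℝ≥0∞) (z - y) * s.indicator 1 z ∂μ₂ := by
        gcongr with z
        exact hpt z
    _ = c * ∫⁻ y, (∫⁻ z, A.indicator (1 : Ed d → ℝ≥0∞) (z - y) * s.indicator 1 z) ∂μ₂ := by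
        congr 1
        exact lintegral_lintegral_swap (μ := volume) (ν := μ₂) (hm.comp measurable_swap).aemeasurable
    _ = ∫⁻ y, (c * ∫⁻ z, A.indicator (1 : Ed d → ℝ≥0∞) (z - y) * s.indicator 1 z) ∂μ₂ :=
        (lintegral_const_mul _ hm.lintegral_prod_right').symm
    _ ≤ ∫⁻ y, ∫⁻ x, s.indicator 1 (y + x) ∂μ₁ ∂μ₂ := lintegral_mono hinner
    _ = (Measure.conv μ₂ μ₁) s := by
        rw [← Measure.lintegral_conv (measurable_one.indicator hs), lintegral_indicator_one hs]

/-- `μ` dominates a positive multiple of Lebesgue measure on the ball `B(a, r)`. -/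
def DominatesBall (μ : Measure (Ed d)) (a : Ed d) (r : ℝ) : Prop :=
  ∃ c : ℝ≥0∞, c ≠ 0 ∧ c • volume.restrict (Metric.ball a r) ≤ μ

lemma DominatesBall.mono {a b : Ed d} {r s : ℝ} (h : DominatesBall μ a r)
    (hs : Metric.ball b s ⊆ Metric.ball a r) : DominatesBall μ b s := by
  obtain ⟨c, hc, h⟩ := h
  refine ⟨c, hc, le_trans (Measure.le_intro fun t _ _ => ?_) h⟩
  rw [Measure.smul_apply, Measure.smul_apply]
  exact mul_le_mul_right (Measure.restrict_mono hs le_rfl t) c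

lemma DominatesBall.conv [SFinite μ₁] [SFinite μ₂] {a b : Ed d} {r s ε : ℝ}
    (h₁ : DominatesBall μ₁ a r) (h₂ : DominatesBall μ₂ b s) (hε : 0 < ε) (hr : ε ≤ r)
    (hs : ε ≤ s) : DominatesBall (Measure.conv μ₁ μ₂) (a + b) (r + s - 2 * ε) := by
  obtain ⟨c₁, hc₁, h₁⟩ := h₁
  obtain ⟨c₂, hc₂, h₂⟩ := h₂
  refine ⟨c₁ * (c₂ * volume (Metric.ball (0 : Ed d) ε)), ?_,
    smul_restrict_le_conv measurableSet_ball measurableSet_ball h₁ fun z hz => ?_⟩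
  · have := (Metric.measure_ball_pos volume (0 : Ed d) hε).ne'
    simp [hc₁, hc₂, this]
  · rw [Metric.mem_ball, dist_eq_norm] at hz
    set w := z - (a + b) with hw
    have hpos : 0 < r + s - 2 * ε := (norm_nonneg _).trans_lt hz
    have hne := hpos.ne'
    set t := (s - ε) / (r + s - 2 * ε) with ht
    have ht0 : 0 ≤ t := div_nonneg (by linarith) hpos.le
    have ht1 : 1 - t = (r - ε) / (r + s - 2 * ε) := by
      rw [ht, eq_div_iff hne, sub_mul, div_mul_cancel₀ _ hne]; ring
    have ht1' : 0 ≤ 1 - t := by rw [ht1]; exact div_nonneg (by linarith) hpos.le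
    have e1 : t * ‖w‖ ≤ s - ε := by
      calc t * ‖w‖ ≤ t * (r + s - 2 * ε) := by gcongr
        _ = s - ε := by rw [ht, div_mul_cancel₀ _ hne]
    have e2 : (1 - t) * ‖w‖ ≤ r - ε := by
      calc (1 - t) * ‖w‖ ≤ (1 - t) * (r + s - 2 * ε) := by gcongr
        _ = r - ε := by rw [ht1, div_mul_cancel₀ _ hne]
    have hsub1 : Metric.ball (b + t • w) ε ⊆ Metric.ball b s := by
      refine Metric.ball_subset_ball' ?_
      rw [dist_eq_norm, add_sub_cancel_left, norm_smul, Real.norm_of_nonneg ht0]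
      linarith
    have hsub2 : Metric.ball (b + t • w) ε ⊆ {y | z - y ∈ Metric.ball a r} := fun y hy => by
      rw [Metric.mem_ball, dist_eq_norm] at hy
      rw [mem_ofPred_eq, Metric.mem_ball, dist_eq_norm]
      have e : z - y - a = (1 - t) • w - (y - (b + t • w)) := by
        rw [hw]; module
      rw [e]
      refine (norm_sub_le _ _).trans_lt ?_
      rw [norm_smul, Real.norm_of_nonneg ht1']
      linarith
    calc c₂ * volume (Metric.ball (0 : Ed d) ε)
        = c₂ * volume (Metric.ball (b + t • w) ε) := by
          rw [Measure.addHaar_ball_center volume (b + t • w)]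
      _ = (c₂ • volume.restrict (Metric.ball b s)) (Metric.ball (b + t • w) ε) := by
          rw [Measure.smul_apply, Measure.restrict_apply measurableSet_ball,
            inter_eq_left.2 hsub1, smul_eq_mul]
      _ ≤ μ₂ (Metric.ball (b + t • w) ε) := h₂ _
      _ ≤ _ := measure_mono hsub2

lemma DominatesBall.conv_of_measure_ball_pos [SFinite μ₁] [SFinite μ₂] {a x : Ed d} {r ε : ℝ}
    (h₁ : DominatesBall μ₁ a r) (h₂ : 0 < μ₂ (Metric.ball x ε)) :
    DominatesBall (Measure.conv μ₁ μ₂) (a + x) (r - ε) := by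
  obtain ⟨c₁, hc₁, h₁⟩ := h₁
  refine ⟨c₁ * μ₂ (Metric.ball x ε), mul_ne_zero hc₁ h₂.ne',
    smul_restrict_le_conv measurableSet_ball measurableSet_ball h₁ fun z hz =>
      measure_mono fun y hy => ?_⟩
  rw [Metric.mem_ball, dist_eq_norm] at hy hz
  rw [mem_ofPred_eq, Metric.mem_ball, dist_eq_norm]
  have e : z - y - a = z - (a + x) - (y - x) := by abel
  rw [e]
  exact (norm_sub_le _ _).trans_lt (by linarith)

lemma DominatesBall.convPow_mul [IsProbabilityMeasure μ] {p : ℕ} {a : Ed d} {r : ℝ}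
    (hr : 0 < r) (h : DominatesBall (convPow d μ p) a r) (n : ℕ) :
    DominatesBall (convPow d μ ((n + 1) * p)) ((n + 1 : ℝ) • a) ((n + 2) * (r / 2)) := by
  have hp := isProbabilityMeasure_convPow (μ := μ)
  induction n with
  | zero =>
    have : (2 : ℝ) * (r / 2) = r := by ring
    simpa [this] using h
  | succ n ih =>
    rw [add_mul (n + 1) 1 p, one_mul, convPow_add]
    have hn : (0 : ℝ) ≤ n := n.cast_nonneg
    convert ih.conv h (ε := r / 4) (by positivity) (by nlinarith) (by linarith) using 1
    · push_cast; module
    · push_cast; ring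

lemma DominatesBall.submodule_eq_top {a : Ed d} {r : ℝ} (hr : 0 < r) (h : DominatesBall μ a r)
    {W : Submodule ℝ (Ed d)} (hW : ∀ᵐ x ∂μ, x ∈ W) : W = ⊤ := by
  by_contra hne
  obtain ⟨c, hc, h⟩ := h
  have h0 : volume.restrict (Metric.ball a r) {x | x ∉ W} = 0 := by
    have := nonpos_iff_eq_zero.1 ((h {x | x ∉ W}).trans_eq (ae_iff.1 hW))
    simpa [hc] using this
  have h1 := Measure.addHaar_submodule volume W hne
  have hb : volume (Metric.ball a r) ≤ 0 := by
    calc volume (Metric.ball a r) = volume.restrict (Metric.ball a r) univ := by simp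
      _ ≤ volume.restrict (Metric.ball a r) ({x | x ∉ W} ∪ W) :=
        measure_mono fun x _ => by by_cases hx : x ∈ W <;> simp [hx]
      _ ≤ volume.restrict (Metric.ball a r) {x | x ∉ W} + volume.restrict (Metric.ball a r) W :=
        measure_union_le _ _
      _ ≤ 0 + volume (W : Set (Ed d)) := add_le_add h0.le (Measure.restrict_apply_le _ _)
      _ = 0 := by rw [h1, zero_add]
  exact absurd hb (not_le.2 (Metric.measure_ball_pos volume a hr))

end BallMinorization

section SpreadOutMinorization

open scoped Topology Pointwise

variable {d : ℕ} {μ : Measure (Ed d)}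

lemma SpreadOut.exists_isCompact (h : SpreadOut d μ) :
    ∃ k, 0 < k ∧ ∃ A : Set (Ed d), IsCompact A ∧ 0 < volume A ∧ ∃ c : ℝ≥0∞, c ≠ 0 ∧
      c • volume.restrict A ≤ convPow d μ k := by
  obtain ⟨k, hk, f, hf, hf0, hpos, hle⟩ := h
  have hint : Integrable f := by
    by_contra hn
    rw [integral_undef hn] at hpos
    exact lt_irrefl _ hpos
  have hsupp : 0 < volume (Function.support f) :=
    (integral_pos_iff_support_of_nonneg hf0 hint).1 hpos
  have hun : Function.support f = ⋃ n : ℕ, {x | 1 / ((n : ℝ) + 1) ≤ f x} := by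
    ext x
    rw [Function.mem_support, mem_iUnion]
    refine ⟨fun hx => ?_, fun ⟨n, hn⟩ => ?_⟩
    · obtain ⟨n, hn⟩ := exists_nat_one_div_lt ((hf0 x).lt_of_ne' hx)
      exact ⟨n, hn.le⟩
    · have : (0 : ℝ) < 1 / ((n : ℝ) + 1) := by positivity
      exact (this.trans_le hn).ne'
  rw [hun] at hsupp
  obtain ⟨n, hn⟩ := exists_measure_pos_of_not_measure_iUnion_null hsupp.ne'
  have hmeas : MeasurableSet {x | 1 / ((n : ℝ) + 1) ≤ f x} := measurableSet_le measurable_const hf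
  obtain ⟨A, hAsub, hAc, hApos⟩ := hmeas.exists_lt_isCompact hn
  have hn0 : (0 : ℝ) < 1 / ((n : ℝ) + 1) := by positivity
  refine ⟨k, hk, A, hAc, hApos, ENNReal.ofReal (1 / ((n : ℝ) + 1)), by simpa using hn0,
    Measure.le_iff.2 fun s hs => ?_⟩
  refine le_trans ?_ (hle s hs)
  rw [ofReal_integral_eq_lintegral_ofReal hint.integrableOn (ae_of_all _ hf0), Measure.smul_apply,
    Measure.restrict_apply hs, smul_eq_mul, ← setLIntegral_const]
  calc ∫⁻ _ in s ∩ A, ENNReal.ofReal (1 / ((n : ℝ) + 1))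
      ≤ ∫⁻ x in s ∩ A, ENNReal.ofReal (f x) :=
        setLIntegral_mono (by fun_prop) fun x hx => ENNReal.ofReal_le_ofReal (hAsub hx.2)
    _ ≤ ∫⁻ x in s, ENNReal.ofReal (f x) := lintegral_mono_set inter_subset_left

lemma exists_measure_inter_reflect_pos {A : Set (Ed d)} (hA : MeasurableSet A)
    (hpos : 0 < volume A) : ∃ z, 0 < volume (A ∩ {y | z - y ∈ A}) := by
  by_contra! hcon
  set D : Set (Ed d × Ed d) := {p | p.2 ∈ A ∧ p.1 - p.2 ∈ A} with hD
  have hDm : MeasurableSet D :=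
    (measurable_snd hA).inter ((measurable_fst.sub measurable_snd) hA)
  have h0 : (volume.prod volume) D = 0 := by
    rw [Measure.prod_apply hDm, lintegral_eq_zero_iff (measurable_measure_prodMk_left hDm)]
    exact ae_of_all _ fun z => nonpos_iff_eq_zero.1 (hcon z)
  rw [Measure.prod_apply_symm hDm] at h0
  have h1 : volume A * volume A ≤ ∫⁻ y, volume ((fun x => (x, y)) ⁻¹' D) := by
    rw [← setLIntegral_const]
    refine le_trans ?_ (setLIntegral_le_lintegral A _)
    refine setLIntegral_mono' hA fun y hy => ?_
    have : (fun x => (x, y)) ⁻¹' D = (fun x => x + -y) ⁻¹' A := by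
      ext x; simp [hD, hy, sub_eq_add_neg]
    rw [this, measure_preimage_add_right]
  rw [h0] at h1
  exact absurd h1 (not_le.2 (ENNReal.mul_pos hpos.ne' hpos.ne'))

lemma SpreadOut.exists_dominatesBall [IsProbabilityMeasure μ] (h : SpreadOut d μ) :
    ∃ p, 0 < p ∧ ∃ a, ∃ r > 0, DominatesBall (convPow d μ p) a r := by
  have hp := isProbabilityMeasure_convPow (μ := μ)
  obtain ⟨k, hk, A, hAc, hApos, c, hc, hle⟩ := h.exists_isCompact
  obtain ⟨z₀, hz₀⟩ := exists_measure_inter_reflect_pos hAc.measurableSet hApos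
  set B := A ∩ {y | z₀ - y ∈ A} with hB
  have hBc : IsCompact B := hAc.inter_right (hAc.isClosed.preimage (by fun_prop))
  have hBfin : volume B ≠ ∞ := hBc.measure_lt_top.ne
  have hev := eventually_nhds_zero_measure_vadd_sdiff_lt (μ := (volume : Measure (Ed d)))
    hBc hBc.isClosed (ε := volume B / 2) (by simpa using hz₀.ne')
  obtain ⟨r, hr, hball⟩ := Metric.eventually_nhds_iff_ball.1 hev
  refine ⟨k + k, by omega, z₀, r, hr, c * (c * (volume B / 2)), ?_, ?_⟩
  · simpa [hc] using hz₀.ne'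
  rw [convPow_add]
  refine smul_restrict_le_conv hAc.measurableSet measurableSet_ball hle fun z hz => ?_
  have hg := hball (z - z₀) (by simpa [dist_eq_norm] using hz)
  have hA' : MeasurableSet {y | z - y ∈ A} := hAc.measurableSet.preimage (by fun_prop)
  refine le_trans ?_ (hle _)
  rw [Measure.smul_apply, Measure.restrict_apply hA', smul_eq_mul]
  gcongr
  have hsub : ((z - z₀) +ᵥ B) ⊆ ({y | z - y ∈ A} ∩ A) ∪ (((z - z₀) +ᵥ B) \ B) := by
    intro y hy
    by_cases hyB : y ∈ B
    · refine Or.inl ⟨?_, hyB.1⟩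
      obtain ⟨x, hx, rfl⟩ := hy
      have := hx.2
      simp only [vadd_eq_add, mem_ofPred_eq] at this ⊢
      convert this using 1
      abel
    · exact Or.inr ⟨hy, hyB⟩
  have hm := (measure_mono hsub).trans (measure_union_le (μ := volume) _ _)
  rw [measure_vadd] at hm
  have h2 : volume B ≤ volume ({y | z - y ∈ A} ∩ A) + volume B / 2 := hm.trans (by gcongr)
  rw [← ENNReal.add_halves (volume B), ENNReal.add_halves] at h2
  nth_rewrite 1 [← ENNReal.add_halves (volume B)] at h2
  exact (ENNReal.add_le_add_iff_right (ENNReal.div_lt_top hBfin (by simp)).ne).1 h2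

lemma convPow_ball_add_pos [IsProbabilityMeasure μ] {m n : ℕ} {x y : Ed d} {r s : ℝ}
    (h₁ : 0 < convPow d μ m (Metric.ball x r)) (h₂ : 0 < convPow d μ n (Metric.ball y s)) :
    0 < convPow d μ (m + n) (Metric.ball (x + y) (r + s)) := by
  have hp := isProbabilityMeasure_convPow (μ := μ)
  rw [convPow_add, Measure.conv, Measure.map_apply (by fun_prop) measurableSet_ball]
  refine (ENNReal.mul_pos h₁.ne' h₂.ne').trans_le ?_
  rw [← Measure.prod_prod]
  refine measure_mono fun p hp => ?_
  have h1 := hp.1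
  have h2 := hp.2
  rw [Metric.mem_ball, dist_eq_norm] at h1 h2
  rw [mem_preimage, Metric.mem_ball, dist_eq_norm, add_sub_add_comm]
  exact (norm_add_le _ _).trans_lt (by linarith)

/-- The directions in which the random walk with step law `μ` can travel asymptotically. -/
def reachSet (μ : Measure (Ed d)) : Set (Ed d) :=
  {v | ∀ ε > 0, ∃ t₀ : ℝ, ∀ t ≥ t₀, ∃ m, 0 < convPow d μ m (Metric.ball (t • v) (ε * t))}

lemma zero_mem_reachSet : (0 : Ed d) ∈ reachSet μ := fun ε hε => ⟨1, fun t ht => ⟨0, by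
  have : (0 : Ed d) ∈ Metric.ball (t • (0 : Ed d)) (ε * t) := by
    rw [smul_zero]
    exact Metric.mem_ball_self (mul_pos hε (by linarith))
  rw [convPow, Measure.dirac_apply' _ measurableSet_ball, indicator_of_mem this]
  simp⟩⟩

/-- `reachSet μ` is a closed convex cone. -/
def reachCone (μ : Measure (Ed d)) [IsProbabilityMeasure μ] : ProperCone ℝ (Ed d) where
  carrier := reachSet μ
  add_mem' {v w} hv hw := fun ε hε => by
    obtain ⟨t₁, h₁⟩ := hv (ε / 2) (by positivity)
    obtain ⟨t₂, h₂⟩ := hw (ε / 2) (by positivity)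
    refine ⟨max t₁ t₂, fun t ht => ?_⟩
    obtain ⟨m, hm⟩ := h₁ t ((le_max_left _ _).trans ht)
    obtain ⟨n, hn⟩ := h₂ t ((le_max_right _ _).trans ht)
    have := convPow_ball_add_pos hm hn
    rw [← smul_add, ← add_mul, add_halves] at this
    exact ⟨m + n, this⟩
  zero_mem' := zero_mem_reachSet
  smul_mem' c v hv := by
    obtain ⟨c, hc⟩ := c
    change c • v ∈ reachSet μ
    rcases hc.eq_or_lt with rfl | hc
    · rw [zero_smul]
      exact zero_mem_reachSet
    intro ε hε
    obtain ⟨t₀, h⟩ := hv (ε / c) (by positivity)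
    refine ⟨t₀ / c, fun t ht => ?_⟩
    obtain ⟨m, hm⟩ := h (t * c) ((div_le_iff₀ hc).1 ht)
    refine ⟨m, ?_⟩
    rwa [mul_smul, div_mul_eq_mul_div, ← mul_assoc, mul_div_cancel_right₀ _ hc.ne'] at hm
  isClosed' := by
    refine isClosed_of_closure_subset fun v hv ε hε => ?_
    obtain ⟨w, hw, hvw⟩ := Metric.mem_closure_iff.1 hv (ε / 2) (by positivity)
    obtain ⟨t₀, h⟩ := hw (ε / 2) (by positivity)
    refine ⟨max t₀ 0, fun t ht => ?_⟩
    obtain ⟨m, hm⟩ := h t ((le_max_left _ _).trans ht)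
    have ht0 : 0 ≤ t := (le_max_right _ _).trans ht
    refine ⟨m, hm.trans_le (measure_mono (Metric.ball_subset_ball' ?_))⟩
    rw [dist_smul₀, Real.norm_of_nonneg ht0, dist_comm]
    nlinarith

lemma mem_reachCone_of_mem_support [IsProbabilityMeasure μ] {x : Ed d} (hx : x ∈ μ.support) :
    x ∈ reachCone μ := by
  have hpos : ∀ r > 0, ∀ n : ℕ,
      0 < convPow d μ (n + 1) (Metric.ball ((n + 1 : ℝ) • x) ((n + 1) * r)) := by
    intro r hr n
    have h1 : 0 < convPow d μ 1 (Metric.ball x r) := by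
      have e : convPow d μ 1 = μ := Measure.dirac_zero_conv μ
      rw [e]
      exact (Measure.mem_support_iff_forall _).1 hx _ (Metric.ball_mem_nhds x hr)
    induction n with
    | zero => simpa using h1
    | succ n ih =>
      have := convPow_ball_add_pos ih h1
      convert this using 3
      · push_cast; module
      · push_cast; ring
  intro ε hε
  refine ⟨max 1 (2 * ‖x‖ / ε), fun t ht => ?_⟩
  have ht1 : 1 ≤ t := (le_max_left _ _).trans ht
  have ht2 : 2 * ‖x‖ ≤ t * ε := (div_le_iff₀ hε).1 ((le_max_right _ _).trans ht)
  obtain ⟨n, hn⟩ := Nat.exists_eq_add_of_le' (Nat.one_le_floor_iff t |>.2 ht1)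
  have h1 : ((n : ℝ) + 1) ≤ t := by
    have := Nat.floor_le (zero_le_one.trans ht1)
    rw [hn] at this
    exact_mod_cast this
  have h2 : t < n + 1 + 1 := by
    have := Nat.lt_floor_add_one t
    rw [hn] at this
    exact_mod_cast this
  refine ⟨n + 1, (hpos (ε / 2) (by positivity) n).trans_le
    (measure_mono (Metric.ball_subset_ball' ?_))⟩
  have e : dist ((n + 1 : ℝ) • x) (t • x) ≤ ‖x‖ := by
    rw [dist_eq_norm, ← sub_smul, norm_smul]
    refine mul_le_of_le_one_left (norm_nonneg _) ?_
    rw [Real.norm_eq_abs, abs_le]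
    constructor <;> linarith
  nlinarith

lemma neg_mem_reachCone [IsProbabilityMeasure μ] (hi : Integrable (fun x => x) μ)
    (h0 : ∫ x, x ∂μ = 0) {p : ℕ} {a : Ed d} {r : ℝ} (hr : 0 < r)
    (h : DominatesBall (convPow d μ p) a r) : -a ∈ reachCone μ := by
  by_contra hn
  obtain ⟨y, hy, hay⟩ := ProperCone.hyperplane_separation' _ hn
  have hnn : 0 ≤ᵐ[μ] fun x => ⟪y, x⟫ := by
    filter_upwards [Measure.support_mem_ae] with x hx
    rw [real_inner_comm]
    exact hy x (mem_reachCone_of_mem_support hx)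
  have hint : ∫ x, ⟪y, x⟫ ∂μ = 0 := by
    rw [integral_inner hi, h0, inner_zero_right]
  have hz := (integral_eq_zero_iff_of_nonneg_ae hnn (hi.const_inner y)).1 hint
  have hW : ∀ᵐ x ∂μ, x ∈ (ℝ ∙ y)ᗮ := by
    filter_upwards [hz] with x hx
    exact Submodule.mem_orthogonal_singleton_iff_inner_right.2 hx
  have htop := h.submodule_eq_top hr (ae_convPow_mem_submodule _ hW p)
  have ha : a ∈ (ℝ ∙ y)ᗮ := by rw [htop]; exact Submodule.mem_top
  have := Submodule.mem_orthogonal_singleton_iff_inner_left.1 ha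
  rw [inner_neg_left, this] at hay
  simp at hay

/-- A centered spread out law has a convolution power which dominates a multiple of Lebesgue
measure on a given ball around the origin. -/
theorem exists_dominatesBall_zero [IsProbabilityMeasure μ] (hi : Integrable (fun x => x) μ)
    (h0 : ∫ x, x ∂μ = 0) (hso : SpreadOut d μ) (R : ℝ) :
    ∃ N, 0 < N ∧ DominatesBall (convPow d μ N) 0 R := by
  have hpc := isProbabilityMeasure_convPow (μ := μ)
  obtain ⟨p, hp, a, r, hr, h⟩ := hso.exists_dominatesBall
  obtain ⟨t₀, ht₀⟩ := neg_mem_reachCone hi h0 hr h (r / 4) (by positivity)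
  obtain ⟨n, hn⟩ := exists_nat_ge (max t₀ (4 * R / r))
  have hn1 : t₀ ≤ n + 1 := by linarith [le_max_left t₀ (4 * R / r)]
  have hn2 : 4 * R ≤ n * r := (div_le_iff₀ hr).1 ((le_max_right _ _).trans hn)
  obtain ⟨m, hm⟩ := ht₀ _ hn1
  have hd := (h.convPow_mul hr n).conv_of_measure_ball_pos hm
  rw [← convPow_add, smul_neg, add_neg_cancel] at hd
  refine ⟨(n + 1) * p + m, by positivity, hd.mono (Metric.ball_subset_ball ?_)⟩
  nlinarith

end SpreadOutMinorization

section Drift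

variable {d : ℕ} {ρ M Δ : ℝ} {Γ : Measure (Ed d)} {g : Ed d → Ed d → ℝ}

lemma exp_le_one_add_self_add_sq_mul_exp_abs (x : ℝ) :
    Real.exp x ≤ 1 + x + x ^ 2 * Real.exp |x| := by
  have h := Complex.norm_exp_sub_sum_le_norm_mul_exp (x : ℂ) 2
  have e : Complex.exp (x : ℂ) - ∑ m ∈ Finset.range 2, (x : ℂ) ^ m / (m.factorial : ℂ) =
      ((Real.exp x - (1 + x) : ℝ) : ℂ) := by
    simp [Finset.sum_range_succ]
  rw [e, Complex.norm_real, Complex.norm_real, Real.norm_eq_abs, Real.norm_eq_abs, sq_abs] at h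
  linarith [le_abs_self (Real.exp x - (1 + x))]

lemma norm_add_le_add_inner_div {F : Type*} [NormedAddCommGroup F] [InnerProductSpace ℝ F]
    {x : F} (hx : x ≠ 0) (u : F) :
    ‖x + u‖ ≤ ‖x‖ + (⟪u, x⟫ / ‖x‖ + ‖u‖ ^ 2 / (2 * ‖x‖)) := by
  have hpos : 0 < ‖x‖ := norm_pos_iff.2 hx
  have h := norm_add_sq_real x u
  rw [real_inner_comm] at h
  have e : ‖x‖ + (⟪u, x⟫ / ‖x‖ + ‖u‖ ^ 2 / (2 * ‖x‖)) =
      (‖x + u‖ ^ 2 + ‖x‖ ^ 2) / (2 * ‖x‖) := by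
    rw [h]
    field_simp
    ring
  rw [e, le_div_iff₀ (by positivity)]
  nlinarith [sq_nonneg (‖x + u‖ - ‖x‖)]

lemma exp_norm_add_le {F : Type*} [NormedAddCommGroup F] [InnerProductSpace ℝ F]
    {x : F} (hx : x ≠ 0) {u : F} {r l l' : ℝ} (hu : ‖u‖ ≤ r) (hl : 0 ≤ l) (hl' : l ≤ l') :
    Real.exp (l * ‖x + u‖) ≤ Real.exp (l * ‖x‖) *
      (1 + l * (⟪u, x⟫ / ‖x‖) + (l / (2 * ‖x‖) + l ^ 2) * (r ^ 2 * Real.exp (l' * r))) := by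
  have hpos : 0 < ‖x‖ := norm_pos_iff.2 hx
  have hr : 0 ≤ r := (norm_nonneg _).trans hu
  have hl'0 : 0 ≤ l' := hl.trans hl'
  set D := ‖x + u‖ - ‖x‖ with hD
  have hD1 : |D| ≤ r := by
    refine le_trans ?_ hu
    have := abs_norm_sub_norm_le (x + u) x
    rwa [add_sub_cancel_left] at this
  have hD2 : D ≤ ⟪u, x⟫ / ‖x‖ + ‖u‖ ^ 2 / (2 * ‖x‖) := by
    linarith [norm_add_le_add_inner_div hx u]
  have e1 : 1 ≤ Real.exp (l' * r) := Real.one_le_exp (mul_nonneg hl'0 hr)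
  have hsq : D ^ 2 ≤ r ^ 2 := sq_le_sq' (by linarith [neg_abs_le D]) (by linarith [le_abs_self D])
  have h1 : Real.exp (l * ‖x + u‖) = Real.exp (l * ‖x‖) * Real.exp (l * D) := by
    rw [← Real.exp_add, hD]; ring_nf
  rw [h1]
  refine mul_le_mul_of_nonneg_left ((exp_le_one_add_self_add_sq_mul_exp_abs _).trans ?_)
    (Real.exp_pos _).le
  have h2 : (l * D) ^ 2 * Real.exp |l * D| ≤ l ^ 2 * (r ^ 2 * Real.exp (l' * r)) := by
    rw [mul_pow, mul_assoc, abs_mul, abs_of_nonneg hl]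
    gcongr
  have h3 : l * D ≤ l * (⟪u, x⟫ / ‖x‖) + l / (2 * ‖x‖) * (r ^ 2 * Real.exp (l' * r)) := by
    have h4 : ‖u‖ ^ 2 / (2 * ‖x‖) ≤ r ^ 2 * Real.exp (l' * r) / (2 * ‖x‖) := by
      gcongr
      calc ‖u‖ ^ 2 ≤ r ^ 2 := by gcongr
        _ ≤ r ^ 2 * Real.exp (l' * r) := le_mul_of_one_le_right (sq_nonneg _) e1
    calc l * D ≤ l * (⟪u, x⟫ / ‖x‖ + r ^ 2 * Real.exp (l' * r) / (2 * ‖x‖)) := by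
          gcongr; linarith
      _ = _ := by ring
  rw [add_mul]
  linarith

lemma integrable_carMeasure (hg : Measurable (Function.uncurry g))
    (h01 : ∀ Λ X, g Λ X ∈ Icc (0 : ℝ) 1) {f B : Ed d → ℝ} (hf : Measurable f) {Λ : Ed d}
    (hB : Integrable B Γ) (h₁ : ∀ X, |f (Λ + (1 - ρ) • X)| ≤ B X)
    (h₂ : ∀ X, |f (Λ - ρ • X)| ≤ B X) : Integrable f (carMeasure d ρ Γ g Λ) := by
  refine ⟨hf.aestronglyMeasurable, ?_⟩
  rw [hasFiniteIntegral_iff_norm, lintegral_carMeasure hg (by fun_prop)]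
  have hB0 : ∀ X, 0 ≤ B X := fun X => (abs_nonneg _).trans (h₁ X)
  refine lt_of_le_of_lt (lintegral_mono fun X => ?_)
    ((hasFiniteIntegral_iff_ofReal (ae_of_all _ hB0)).1 hB.2)
  have hg0 := (h01 Λ X).1
  have hg1 : 0 ≤ 1 - g Λ X := by linarith [(h01 Λ X).2]
  rw [← ENNReal.ofReal_mul hg0, ← ENNReal.ofReal_mul hg1,
    ← ENNReal.ofReal_add (by positivity) (by positivity)]
  refine ENNReal.ofReal_le_ofReal ?_
  rw [Real.norm_eq_abs, Real.norm_eq_abs]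
  nlinarith [mul_le_mul_of_nonneg_left (h₁ X) hg0, mul_le_mul_of_nonneg_left (h₂ X) hg1]

lemma sq_mul_exp_half_le {l : ℝ} (hl : 0 < l) {x : ℝ} (hx : 0 ≤ x) :
    x ^ 2 * Real.exp (l / 2 * x) ≤ 8 / l ^ 2 * Real.exp (l * x) := by
  have h := Real.quadratic_le_exp_of_nonneg (x := l / 2 * x) (by positivity)
  have h1 : x ^ 2 ≤ 8 / l ^ 2 * Real.exp (l / 2 * x) := by
    rw [div_mul_eq_mul_div, le_div_iff₀ (by positivity)]
    have : 0 ≤ l / 2 * x := by positivity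
    nlinarith
  calc x ^ 2 * Real.exp (l / 2 * x)
      ≤ 8 / l ^ 2 * Real.exp (l / 2 * x) * Real.exp (l / 2 * x) := by gcongr
    _ = _ := by rw [mul_assoc, ← Real.exp_add]; ring_nf

/-- Foster-Lyapunov drift for `exp (lam * ‖·‖)`, with constants uniform in the allocation
function. -/
theorem exists_exponential_drift [IsProbabilityMeasure Γ] (hρ : ρ ∈ Ioo (0 : ℝ) 1) (hM : 0 < M)
    (hΔ : 0 < Δ) (hsub : SubExp d Γ) :
    ∃ lam > (0 : ℝ), ∃ β ∈ Ioo (0 : ℝ) 1, ∃ b > (0 : ℝ), ∀ g : Ed d → Ed d → ℝ,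
      Measurable (Function.uncurry g) → (∀ Λ X, g Λ X ∈ Icc (0 : ℝ) 1) →
      (∀ Λ, M ≤ ‖Λ‖ → ∫ X, (g Λ X - ρ) * (⟪X, Λ⟫ / ‖Λ‖) ∂Γ ≤ -Δ) →
      ∀ Λ, Integrable (fun x => Real.exp (lam * ‖x‖)) (carMeasure d ρ Γ g Λ) ∧
        ∫ x, Real.exp (lam * ‖x‖) ∂carMeasure d ρ Γ g Λ ≤ β * Real.exp (lam * ‖Λ‖) + b := by
  obtain ⟨l, hl, hexp⟩ := hsub
  have hC : Integrable (fun X : Ed d => ‖X‖ ^ 2 * Real.exp (l / 2 * ‖X‖)) Γ := by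
    refine (hexp.const_mul (8 / l ^ 2)).mono' (by fun_prop) (ae_of_all _ fun X => ?_)
    rw [Real.norm_of_nonneg (by positivity)]
    exact sq_mul_exp_half_le hl (norm_nonneg X)
  set C := ∫ X : Ed d, ‖X‖ ^ 2 * Real.exp (l / 2 * ‖X‖) ∂Γ with hCdef
  have hC0 : 0 ≤ C := integral_nonneg fun X => by positivity
  clear_value C
  have hnorm : Integrable (fun X : Ed d => ‖X‖) Γ := by
    refine ((integrable_const 1).add hC).mono' (by fun_prop) (ae_of_all _ fun X => ?_)
    rw [norm_norm, Pi.add_apply]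
    have h1 : 1 ≤ Real.exp (l / 2 * ‖X‖) := Real.one_le_exp (by positivity)
    nlinarith [sq_nonneg (‖X‖ - 1), le_mul_of_one_le_right (sq_nonneg ‖X‖) h1]
  set lam := min (l / 2) (min (Δ / (4 * (C + 1))) (1 / Δ)) with hlam
  have hlam0 : 0 < lam := by positivity
  have hlam1 : lam ≤ l / 2 := min_le_left _ _
  have hlam2 : lam * C ≤ Δ / 4 := by
    have : lam ≤ Δ / (4 * (C + 1)) := (min_le_right _ _).trans (min_le_left _ _)
    rw [le_div_iff₀ (by positivity)] at this
    nlinarith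
  have hlam3 : lam * Δ ≤ 1 := by
    have : lam ≤ 1 / Δ := (min_le_right _ _).trans (min_le_right _ _)
    rwa [le_div_iff₀ hΔ] at this
  clear_value lam
  obtain ⟨M', hM', hM'C⟩ : ∃ M', M ≤ M' ∧ C / Δ ≤ M' := ⟨_, le_max_left _ _, le_max_right _ _⟩
  have hM'0 : 0 < M' := hM.trans_le hM'
  have hIpos : 0 < ∫ X : Ed d, Real.exp (l * ‖X‖) ∂Γ := integral_exp_pos hexp
  refine ⟨lam, hlam0, 1 - lam * Δ / 4, ⟨by linarith, by nlinarith [mul_pos hlam0 hΔ]⟩,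
    Real.exp (lam * M') * ∫ X, Real.exp (l * ‖X‖) ∂Γ, by positivity, fun g hg h01 hneg Λ => ?_⟩
  have hVm : Measurable fun x : Ed d => Real.exp (lam * ‖x‖) := by fun_prop
  have hgΛ : Measurable (g Λ) := hg.of_uncurry_left
  have hu1 : ∀ X : Ed d, ‖(1 - ρ) • X‖ ≤ ‖X‖ := fun X => by
    rw [norm_smul, Real.norm_of_nonneg (by linarith [hρ.2])]
    exact mul_le_of_le_one_left (norm_nonneg _) (by linarith [hρ.1])
  have hu2 : ∀ X : Ed d, ‖-(ρ • X)‖ ≤ ‖X‖ := fun X => by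
    rw [norm_neg, norm_smul, Real.norm_of_nonneg hρ.1.le]
    exact mul_le_of_le_one_left (norm_nonneg _) hρ.2.le
  have hbd : ∀ X u : Ed d, ‖u‖ ≤ ‖X‖ →
      Real.exp (lam * ‖Λ + u‖) ≤ Real.exp (lam * ‖Λ‖) * Real.exp (l * ‖X‖) := fun X u hu => by
    rw [← Real.exp_add]
    refine Real.exp_le_exp.2 ?_
    have h1 : lam * ‖Λ + u‖ ≤ lam * (‖Λ‖ + ‖X‖) := by
      gcongr
      exact (norm_add_le _ _).trans (by linarith)
    have h2 : lam * ‖X‖ ≤ l * ‖X‖ := by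
      gcongr
      linarith
    linarith
  have hB := hexp.const_mul (Real.exp (lam * ‖Λ‖))
  have hi : Integrable (fun x => Real.exp (lam * ‖x‖)) (carMeasure d ρ Γ g Λ) := by
    refine integrable_carMeasure hg h01 hVm hB (fun X => ?_) fun X => ?_
    · rw [abs_of_pos (Real.exp_pos _)]
      exact hbd X _ (hu1 X)
    · rw [abs_of_pos (Real.exp_pos _), sub_eq_add_neg]
      exact hbd X _ (hu2 X)
  refine ⟨hi, ?_⟩
  rw [integral_carMeasure hg h01 hVm hi, kernelOp]
  have hnn : ∀ X, 0 ≤ g Λ X * Real.exp (lam * ‖Λ + (1 - ρ) • X‖) +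
      (1 - g Λ X) * Real.exp (lam * ‖Λ - ρ • X‖) := fun X => by
    have h1 := (h01 Λ X).1
    have h2 : 0 ≤ 1 - g Λ X := by linarith [(h01 Λ X).2]
    positivity
  rcases le_total ‖Λ‖ M' with hΛ | hΛ
  · have h1 : ∫ X, g Λ X * Real.exp (lam * ‖Λ + (1 - ρ) • X‖) +
        (1 - g Λ X) * Real.exp (lam * ‖Λ - ρ • X‖) ∂Γ ≤
        ∫ X, Real.exp (lam * ‖Λ‖) * Real.exp (l * ‖X‖) ∂Γ := by
      refine integral_mono_of_nonneg (ae_of_all _ hnn) hB (ae_of_all _ fun X => ?_)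
      have h1 := hbd X _ (hu1 X)
      have h2 := hbd X _ (hu2 X)
      rw [← sub_eq_add_neg] at h2
      have hg0 := (h01 Λ X).1
      have hg1 : 0 ≤ 1 - g Λ X := by linarith [(h01 Λ X).2]
      have := mul_le_mul_of_nonneg_left h1 hg0
      have := mul_le_mul_of_nonneg_left h2 hg1
      simp only
      linarith
    rw [integral_const_mul] at h1
    have h2 : Real.exp (lam * ‖Λ‖) * ∫ X, Real.exp (l * ‖X‖) ∂Γ ≤
        Real.exp (lam * M') * ∫ X, Real.exp (l * ‖X‖) ∂Γ := by gcongr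
    have h3 : 0 ≤ (1 - lam * Δ / 4) * Real.exp (lam * ‖Λ‖) :=
      mul_nonneg (by linarith) (Real.exp_pos _).le
    linarith
  · have hΛpos : 0 < ‖Λ‖ := hM'0.trans_le hΛ
    have hΛ0 : Λ ≠ 0 := norm_pos_iff.1 hΛpos
    have hfb : Integrable (fun X => (g Λ X - ρ) * (⟪X, Λ⟫ / ‖Λ‖)) Γ := by
      refine hnorm.mono' (by fun_prop) (ae_of_all _ fun X => ?_)
      have h1 : |g Λ X - ρ| ≤ 1 := abs_le.2
        ⟨by linarith [(h01 Λ X).1, hρ.2], by linarith [(h01 Λ X).2, hρ.1]⟩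
      have h2 : |⟪X, Λ⟫ / ‖Λ‖| ≤ ‖X‖ := by
        rw [abs_div, abs_norm, div_le_iff₀ hΛpos]
        exact abs_real_inner_le_norm X Λ
      rw [Real.norm_eq_abs, abs_mul]
      nlinarith [abs_nonneg (g Λ X - ρ), abs_nonneg (⟪X, Λ⟫ / ‖Λ‖)]
    have hfl : Integrable (fun X => 1 + lam * ((g Λ X - ρ) * (⟪X, Λ⟫ / ‖Λ‖))) Γ :=
      (integrable_const 1).add (hfb.const_mul lam)
    have hbound : Integrable (fun X => Real.exp (lam * ‖Λ‖) *
        ((1 + lam * ((g Λ X - ρ) * (⟪X, Λ⟫ / ‖Λ‖))) + (lam / (2 * ‖Λ‖) + lam ^ 2) *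
          (‖X‖ ^ 2 * Real.exp (l / 2 * ‖X‖)))) Γ :=
      (hfl.add (hC.const_mul _)).const_mul _
    have h1 := integral_mono_of_nonneg (ae_of_all _ hnn) hbound (ae_of_all _ fun X => by
      have h1 := exp_norm_add_le hΛ0 (hu1 X) hlam0.le hlam1
      have h2 := exp_norm_add_le hΛ0 (hu2 X) hlam0.le hlam1
      rw [← sub_eq_add_neg, inner_neg_left, real_inner_smul_left] at h2
      rw [real_inner_smul_left] at h1
      have hg0 := (h01 Λ X).1
      have hg1 : 0 ≤ 1 - g Λ X := by linarith [(h01 Λ X).2]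
      refine (add_le_add (mul_le_mul_of_nonneg_left h1 hg0)
        (mul_le_mul_of_nonneg_left h2 hg1)).trans (le_of_eq ?_)
      ring)
    refine h1.trans ?_
    rw [integral_const_mul, integral_add hfl
      (hC.const_mul _), integral_add (integrable_const 1) (hfb.const_mul lam),
      integral_const_mul, integral_const_mul, ← hCdef]
    have h2 := hneg Λ (hM'.trans hΛ)
    have h3 : C / (2 * ‖Λ‖) ≤ Δ / 2 := by
      have : C ≤ ‖Λ‖ * Δ := (div_le_iff₀ hΔ).1 (hM'C.trans hΛ)
      rw [div_le_iff₀ (by positivity)]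
      nlinarith
    have h4 : (∫ _ : Ed d, (1 : ℝ) ∂Γ) + lam * ∫ X, (g Λ X - ρ) * (⟪X, Λ⟫ / ‖Λ‖) ∂Γ +
        (lam / (2 * ‖Λ‖) + lam ^ 2) * C ≤ 1 - lam * Δ / 4 := by
      have e : (lam / (2 * ‖Λ‖) + lam ^ 2) * C = lam * (C / (2 * ‖Λ‖)) + lam * (lam * C) := by
        ring
      rw [e, integral_const, probReal_univ, one_smul]
      have := mul_le_mul_of_nonneg_left h2 hlam0.le
      have := mul_le_mul_of_nonneg_left h3 hlam0.le
      have := mul_le_mul_of_nonneg_left hlam2 hlam0.le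
      linarith
    have h5 := mul_le_mul_of_nonneg_left h4 (Real.exp_pos (lam * ‖Λ‖)).le
    have h6 : 0 ≤ Real.exp (lam * M') * ∫ X, Real.exp (l * ‖X‖) ∂Γ := by positivity
    linarith

end Drift

section Assembly

variable {d : ℕ} {ρ ι : ℝ} {Γ : Measure (Ed d)}

lemma integrable_norm_of_subExp [IsProbabilityMeasure Γ] (h : SubExp d Γ) :
    Integrable (fun x => x) Γ := by
  obtain ⟨l, hl, h⟩ := h
  refine (h.const_mul l⁻¹).mono' (by fun_prop) (ae_of_all _ fun x => ?_)
  rw [inv_mul_eq_div, le_div_iff₀ hl]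
  linarith [Real.add_one_le_exp (l * ‖x‖)]

lemma integrable_mixMeasure (h : Integrable (fun x => x) Γ) :
    Integrable (fun x => x) (mixMeasure d ρ Γ) := by
  refine Integrable.add_measure (Integrable.smul_measure ?_ ENNReal.ofReal_ne_top)
    (Integrable.smul_measure ?_ ENNReal.ofReal_ne_top)
  · exact (integrable_map_measure (by fun_prop) (by fun_prop)).2 (h.smul (1 - ρ))
  · exact (integrable_map_measure (by fun_prop) (by fun_prop)).2 (h.smul (-ρ))

lemma integral_mixMeasure (hρ : ρ ∈ Ioo (0 : ℝ) 1) (h : Integrable (fun x => x) Γ) :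
    ∫ x, x ∂mixMeasure d ρ Γ = 0 := by
  have hi := integrable_mixMeasure (ρ := ρ) h
  rw [mixMeasure] at hi ⊢
  rw [integral_add_measure hi.left_of_add_measure hi.right_of_add_measure,
    integral_smul_measure, integral_smul_measure, integral_map (by fun_prop) (by fun_prop),
    integral_map (by fun_prop) (by fun_prop), integral_smul, integral_smul,
    ENNReal.toReal_ofReal hρ.1.le, ENNReal.toReal_ofReal (by linarith [hρ.2])]
  module

lemma suppSpan_eq_top [IsProbabilityMeasure Γ] (hρ : ρ ∈ Ioo (0 : ℝ) 1)
    (hso : SpreadOut d (mixMeasure d ρ Γ)) : suppSpan d Γ = ⊤ := by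
  have hp := isProbabilityMeasure_mixMeasure (Γ := Γ) hρ
  obtain ⟨p, -, a, r, hr, h⟩ := hso.exists_dominatesBall
  refine h.submodule_eq_top hr (ae_convPow_mem_submodule _ ?_ p)
  have hW : MeasurableSet {x | x ∈ suppSpan d Γ} :=
    (suppSpan d Γ).closed_of_finiteDimensional.measurableSet
  have hΓ : ∀ᵐ x ∂Γ, x ∈ suppSpan d Γ := by
    filter_upwards [Measure.support_mem_ae] with x hx
    exact Submodule.subset_span fun U hU hxU =>
      (Measure.mem_support_iff_forall _).1 hx U (hU.mem_nhds hxU)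
  rw [mixMeasure, ae_add_measure_iff]
  refine ⟨Measure.ae_smul_measure ((ae_map_iff (by fun_prop) hW).2 ?_) _,
    Measure.ae_smul_measure ((ae_map_iff (by fun_prop) hW).2 ?_) _⟩
  · exact hΓ.mono fun x hx => Submodule.smul_mem _ _ hx
  · exact hΓ.mono fun x hx => Submodule.smul_mem _ _ hx

/-- Minorization of the `N`-step kernels on a ball, uniform in the allocation function. -/
lemma exists_minorization [IsProbabilityMeasure Γ] (hρ : ρ ∈ Ioo (0 : ℝ) 1)
    (hι : ι ∈ Ioo (0 : ℝ) (1 / 2)) (hi : Integrable (fun x => x) Γ)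
    (hso : SpreadOut d (mixMeasure d ρ Γ)) (R : ℝ) :
    ∃ N, 0 < N ∧ ∃ ν : Measure (Ed d), IsFiniteMeasure ν ∧ 0 < ν.real univ ∧
      ∀ (g : Ed d → Ed d → ℝ) (hg : Measurable (Function.uncurry g)),
        (∀ Λ X, g Λ X ∈ Icc ι (1 - ι)) →
        ∀ Λ, ‖Λ‖ ≤ R → ν ≤ (carKernel d ρ Γ g hg ^ N) Λ := by
  have hp := isProbabilityMeasure_mixMeasure (Γ := Γ) hρ
  obtain ⟨N, hN, c, hc, hle⟩ := exists_dominatesBall_zero (integrable_mixMeasure (ρ := ρ) hi)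
    (integral_mixMeasure hρ hi) hso (R + 1)
  set c' := ENNReal.ofReal ι ^ N * min c 1 with hc'
  have hc'0 : c' ≠ 0 := mul_ne_zero (pow_ne_zero _ (by simpa using hι.1))
    (lt_min (pos_iff_ne_zero.2 hc) one_pos).ne'
  have hc'top : c' ≠ ∞ := ENNReal.mul_ne_top (ENNReal.pow_ne_top ENNReal.ofReal_ne_top)
    (ne_top_of_le_ne_top ENNReal.one_ne_top (min_le_right _ _))
  have hfin : IsFiniteMeasure (volume.restrict (Metric.ball (0 : Ed d) 1)) :=
    ⟨by simpa using measure_ball_lt_top⟩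
  have hν : IsFiniteMeasure (c' • volume.restrict (Metric.ball (0 : Ed d) 1)) :=
    Measure.smul_finite _ hc'top
  refine ⟨N, hN, c' • volume.restrict (Metric.ball (0 : Ed d) 1), hν, ?_,
    fun g hg hgι Λ hΛ => Measure.le_iff.2 fun s hs => ?_⟩
  · refine ENNReal.toReal_pos ?_ (measure_ne_top _ _)
    rw [Measure.smul_apply, Measure.restrict_apply_univ, smul_eq_mul]
    exact mul_ne_zero hc'0 (Metric.measure_ball_pos volume (0 : Ed d) one_pos).ne'
  have hm : Measurable (s.indicator (1 : Ed d → ℝ≥0∞)) := measurable_one.indicator hs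
  have hpre : MeasurableSet ((fun y => Λ + y) ⁻¹' s) := hs.preimage (by fun_prop)
  have h1 := le_lintegral_carKernel_pow (Γ := Γ) hg hρ hι.1.le hgι N hm Λ
  rw [lintegral_indicator_one hs] at h1
  refine le_trans ?_ h1
  have e : ∫⁻ y, s.indicator 1 (Λ + y) ∂convPow d (mixMeasure d ρ Γ) N =
      convPow d (mixMeasure d ρ Γ) N ((fun y => Λ + y) ⁻¹' s) := by
    rw [← lintegral_indicator_one hpre]
    rfl
  rw [e, hc', Measure.smul_apply, smul_eq_mul, mul_assoc]
  gcongr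
  refine le_trans ?_ (hle _)
  rw [Measure.smul_apply, smul_eq_mul, Measure.restrict_apply hs, Measure.restrict_apply hpre]
  refine mul_le_mul' (min_le_left _ _) ?_
  rw [← measure_preimage_add volume Λ (s ∩ Metric.ball 0 1)]
  refine measure_mono fun y hy => ⟨hy.1, ?_⟩
  have h2 := hy.2
  rw [mem_ball_zero_iff] at h2 ⊢
  calc ‖y‖ = ‖Λ + y - Λ‖ := by rw [add_sub_cancel_left]
    _ ≤ ‖Λ + y‖ + ‖Λ‖ := norm_sub_le _ _
    _ < R + 1 := by linarith

end Assembly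

/-- Simultaneous geometric ergodicity of the CAR kernels: under sub-exponential `Γ`,
spread-out `Γ_ρ` and the `(M,Δ)`-negative feedback condition, every allocation function
with values in `[ι, 1−ι]` yields a kernel with a unique invariant probability measure,
finite `V`-moment, and a geometric `V`-norm convergence rate, with constants uniform in `g`. -/
theorem stmt6 (d : ℕ) (ρ ι M Δ : ℝ) (hρ : ρ ∈ Set.Ioo (0 : ℝ) 1)
    (hι : ι ∈ Set.Ioo (0 : ℝ) (1 / 2)) (hM : 0 < M) (hΔ : 0 < Δ)
    (Γ : Measure (Ed d)) [IsProbabilityMeasure Γ]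
    (hsub : SubExp d Γ) (hso : SpreadOut d (mixMeasure d ρ Γ)) :
    ∃ lam₁ > (0 : ℝ), ∃ β ∈ Set.Ioo (0 : ℝ) 1, ∃ b > (0 : ℝ), ∃ L > (1 : ℝ),
      ∀ g : Ed d → Ed d → ℝ, Measurable (Function.uncurry g) →
        (∀ Λ X, g Λ X ∈ Set.Icc ι (1 - ι)) →
        NegFeedback d ρ M Δ Γ g →
        ∃ π : Measure (Ed d), IsProbabilityMeasure π ∧
          IsInvariantMeasure d ρ Γ g π ∧
          (∀ π' : Measure (Ed d), IsProbabilityMeasure π' →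
            IsInvariantMeasure d ρ Γ g π' → π' = π) ∧
          (∫ Λ, Real.exp (lam₁ * ‖Λ‖) ∂π) ≤ b / (1 - β) ∧
          ∀ (n : ℕ) (Λ : Ed d) (f : Ed d → ℝ), Measurable f →
            (∀ x, |f x| ≤ Real.exp (lam₁ * ‖x‖)) →
            |(kernelOp d ρ Γ g)^[n] f Λ - ∫ x, f x ∂π|
              ≤ L * (1 - L⁻¹) ^ n * Real.exp (lam₁ * ‖Λ‖) := by
  obtain ⟨lam, hlam, β, hβ, b, hb, hdrift⟩ := exists_exponential_drift hρ hM hΔ hsub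
  have hβ1 : 0 < 1 - β := by linarith [hβ.2]
  set R := (2 * (b / (1 - β)) + 1) / (1 - β) with hRdef
  have hR : 2 * (b / (1 - β)) < (1 - β) * R := by
    rw [hRdef, mul_div_cancel₀ _ hβ1.ne']
    linarith
  obtain ⟨N, hN, ν, hν, hνpos, hmin⟩ := exists_minorization hρ hι
    (integrable_norm_of_subExp hsub) hso (Real.log R / lam)
  obtain ⟨L, hL, H⟩ := harris_theorem (E := Ed d) hβ hb hR hνpos hN
  refine ⟨lam, hlam, β, hβ, b, hb, L, hL, fun g hg hgι hneg => ?_⟩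
  have h01 : ∀ Λ X, g Λ X ∈ Icc (0 : ℝ) 1 := fun Λ X =>
    ⟨hι.1.le.trans (hgι Λ X).1, (hgι Λ X).2.trans (by linarith [hι.1])⟩
  have hM' := isMarkovKernel_carKernel (ρ := ρ) (Γ := Γ) hg h01
  have hVm : Measurable fun x : Ed d => Real.exp (lam * ‖x‖) := by fun_prop
  have hdr := hdrift g hg h01 fun Λ hΛ =>
    hneg Λ (by rw [suppSpan_eq_top hρ hso]; exact Submodule.mem_top) hΛ
  have hminR : ∀ Λ : Ed d, Real.exp (lam * ‖Λ‖) ≤ R → ν ≤ (carKernel d ρ Γ g hg ^ N) Λ :=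
    fun Λ hΛ => hmin g hg hgι Λ <| by
      rw [le_div_iff₀ hlam, mul_comm]
      exact (Real.le_log_iff_exp_le ((Real.exp_pos _).trans_le hΛ)).2 hΛ
  obtain ⟨π, hπ, hinv, huniq, hV, hconv⟩ := H (fun x => Real.exp (lam * ‖x‖)) hVm
    (fun x => Real.one_le_exp (by positivity)) (carKernel d ρ Γ g hg) hM'
    (fun Λ => (hdr Λ).1) (fun Λ => (hdr Λ).2) ⟨ν, hν, rfl, hminR⟩
  refine ⟨π, hπ, (isInvariantMeasure_iff hg h01 π).2 hinv,
    fun π' hπ' h' => huniq π' hπ' ((isInvariantMeasure_iff hg h01 π').1 h'), hV,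
    fun n Λ f hf hfV => ?_⟩
  rw [iterate_kernelOp_eq hg h01 hf fun n Λ =>
    (drift_pow hVm (fun x => (Real.exp_pos _).le) hβ (fun Λ => (hdr Λ).1)
      (fun Λ => (hdr Λ).2) n Λ).1.mono' hf.aestronglyMeasurable (ae_of_all _ hfV)]
  exact hconv n Λ f hf hfV
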